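/- Let Ω ⊂ ℝ^d be a nonempty, bounded, uniform domain, let 0 < s < 1, 1 ≤ p < ∞ and 0 < θ ≤ 1, and suppose 0 ≤ α, β < codim̲_A(∂Ω). Then there exists a constant C = C(θ,d,s,p,α,β,Ω) > 0 such that for every f ∈ L¹_loc(Ω) one has ∫_Ω ∫_Ω |f(x)−f(y)|^p |x−y|^{−d−sp} d_Ω(y)^{−β} d_Ω(x)^{−α} dy dx ≤ C ∫_Ω ∫_{B(x, θ d_Ω(x))} |f(x)−f(y)|^p |x−y|^{−d−sp} d_Ω(y)^{−β} d_Ω(x)^{−α} dy dx; in particular (since the reverse inequality holds with constant 1) the full and truncated weighted Gagliardo seminorms are comparable. -/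

import Mathlib

open MeasureTheory Metric Set Filter
open scoped ENNReal NNReal

noncomputable section

/-- Euclidean space `ℝ^d`. -/
abbrev Rd (d : ℕ) := EuclideanSpace ℝ (Fin d)

/-- `d_Ω(x)`: the distance from `x` to the boundary `∂Ω`. -/
def distBd {d : ℕ} (Ω : Set (Rd d)) (x : Rd d) : ℝ := Metric.infDist x (frontier Ω)

/-- The `p`-th power of the weighted Gagliardo seminorm `[f]_{W^{s,p;α,β}(Ω)}^p`, with
power-of-distance-to-the-boundary weights `d_Ω(y)^{-β} d_Ω(x)^{-α}`. -/
def gagP {d : ℕ} (Ω : Set (Rd d)) (s p α β : ℝ) (f : Rd d → ℝ) : ℝ≥0∞ :=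
  ∫⁻ x in Ω, ∫⁻ y in Ω, ENNReal.ofReal
    (|f x - f y| ^ p / dist x y ^ ((d : ℝ) + s * p)
      * distBd Ω y ^ (-β) * distBd Ω x ^ (-α))

/-- The weighted Gagliardo seminorm `[f]_{W^{s,p;α,β}(Ω)}`. -/
def gagSemi {d : ℕ} (Ω : Set (Rd d)) (s p α β : ℝ) (f : Rd d → ℝ) : ℝ≥0∞ :=
  gagP Ω s p α β f ^ (1 / p)

/-- Membership in the weighted fractional Sobolev space `W^{s,p;α,β}(Ω)`. -/
def memW {d : ℕ} (Ω : Set (Rd d)) (s p α β : ℝ) (f : Rd d → ℝ) : Prop :=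
  MemLp f (ENNReal.ofReal p) (volume.restrict Ω) ∧ gagP Ω s p α β f < ⊤

/-- The norm `‖f‖_{L^p(Ω)} + [f]_{W^{s,p;α,β}(Ω)}` (as an extended real). -/
def wNorm {d : ℕ} (Ω : Set (Rd d)) (s p α β : ℝ) (f : Rd d → ℝ) : ℝ≥0∞ :=
  eLpNorm f (ENNReal.ofReal p) (volume.restrict Ω) + gagSemi Ω s p α β f

/-- Membership in `W_0^{s,p;α,β}(Ω)`: the closure of `C_c^∞(Ω) ∩ W^{s,p;α,β}(Ω)` in
`W^{s,p;α,β}(Ω)`. -/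
def memW0 {d : ℕ} (Ω : Set (Rd d)) (s p α β : ℝ) (f : Rd d → ℝ) : Prop :=
  memW Ω s p α β f ∧ ∀ ε : ℝ, 0 < ε → ∃ φ : Rd d → ℝ,
    ContDiff ℝ (⊤ : ℕ∞) φ ∧ HasCompactSupport φ ∧ tsupport φ ⊆ Ω ∧ memW Ω s p α β φ ∧
    wNorm Ω s p α β (fun x => f x - φ x) < ENNReal.ofReal ε

/-- The defining set for the lower Assouad codimension: admissible exponents `q`. -/
def lowerCodimSet {d : ℕ} (E : Set (Rd d)) : Set ℝ :=
  {q : ℝ | 0 ≤ q ∧ ∃ C : ℝ, 1 ≤ C ∧ ∀ x ∈ E, ∀ r R : ℝ, 0 < r → r < R →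
    ENNReal.ofReal R < EMetric.diam E →
    volume (Metric.cthickening r E ∩ Metric.ball x R)
      ≤ ENNReal.ofReal (C * (r / R) ^ q) * volume (Metric.ball x R)}

/-- The lower Assouad codimension. -/
def lowerCodimA {d : ℕ} (E : Set (Rd d)) : ℝ := sSup (lowerCodimSet E)

/-- The upper Assouad codimension. -/
def upperCodimA {d : ℕ} (E : Set (Rd d)) : ℝ :=
  sInf {q : ℝ | 0 ≤ q ∧ ∃ c : ℝ, 0 < c ∧ ∀ x ∈ E, ∀ r R : ℝ, 0 < r → r < R →
    ENNReal.ofReal R < EMetric.diam E →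
    ENNReal.ofReal (c * (r / R) ^ q) * volume (Metric.ball x R)
      ≤ volume (Metric.cthickening r E ∩ Metric.ball x R)}

/-- The upper Minkowski dimension. -/
def upperMinkDim {d : ℕ} (E : Set (Rd d)) : ℝ :=
  sInf {t : ℝ | 0 ≤ t ∧
    Filter.limsup (fun r : ℝ =>
        volume (Metric.cthickening r E) * ENNReal.ofReal (r ^ (t - (d : ℝ))))
      (nhdsWithin 0 (Set.Ioi 0)) = 0}

/-- Uniform domain: any two points are joined by a `1`-Lipschitz (arc-length parameterized)
curve of length `≤ C|x-y|` staying quantitatively away from the boundary. -/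
def IsUniformDomain {d : ℕ} (Ω : Set (Rd d)) : Prop :=
  ∃ C : ℝ, 1 ≤ C ∧ ∀ x ∈ Ω, ∀ y ∈ Ω, ∃ (l : ℝ) (γ : ℝ → Rd d),
    0 ≤ l ∧ l ≤ C * dist x y ∧ γ 0 = x ∧ γ l = y ∧
    (∀ t ∈ Set.Icc 0 l, γ t ∈ Ω) ∧
    LipschitzOnWith 1 γ (Set.Icc 0 l) ∧
    ∀ t ∈ Set.Icc 0 l,
      min (dist (γ t) x) (dist (γ t) y) / C ≤ Metric.infDist (γ t) (frontier Ω)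

/-- `κ`-plumpness. -/
def IsPlump {d : ℕ} (κ : ℝ) (E : Set (Rd d)) : Prop :=
  ∀ r : ℝ, 0 < r → ENNReal.ofReal r < EMetric.diam E →
    ∀ x ∈ closure E, ∃ z ∈ Metric.closedBall x r, Metric.ball z (κ * r) ⊆ E

/-- `σ`-homogeneity: `|V(E,x,λ,r)| ≤ L r^d λ^σ` where
`V(E,x,λ,r) = {y : dist(y,E) ≤ r, |x-y| ≤ λ r}`. -/
def IsHomog {d : ℕ} (σ : ℝ) (E : Set (Rd d)) : Prop :=
  ∃ L : ℝ, 0 < L ∧ ∀ x ∈ E, ∀ lam r : ℝ, 1 ≤ lam → 0 < r →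
    volume (Metric.cthickening r E ∩ Metric.closedBall x (lam * r))
      ≤ ENNReal.ofReal (L * r ^ (d : ℝ) * lam ^ σ)

/-- The axis-parallel cube with corner `a` and side length `l`. -/
def cube {d : ℕ} (a : Rd d) (l : ℝ) : Set (Rd d) :=
  {y | ∀ i, y i ∈ Set.Icc (a i) (a i + l)}

/-- Muckenhoupt `A₁` class: `|Q|⁻¹ ∫_Q w ≤ A inf_Q w` for all cubes `Q`. -/
def IsA1 {d : ℕ} (w : Rd d → ℝ) : Prop :=
  (∀ x, 0 < w x) ∧ ∃ A : ℝ, 0 < A ∧ ∀ (a : Rd d) (l : ℝ), 0 < l →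
    ∫⁻ x in cube a l, ENNReal.ofReal (w x)
      ≤ ENNReal.ofReal (A * l ^ (d : ℝ)) * ⨅ y ∈ cube a l, ENNReal.ofReal (w y)

/-- The `p`-th power of the Gagliardo seminorm with general weights `w(x) v(y)`. -/
def gagPW {d : ℕ} (Ω : Set (Rd d)) (s p : ℝ) (w v f : Rd d → ℝ) : ℝ≥0∞ :=
  ∫⁻ x in Ω, ∫⁻ y in Ω, ENNReal.ofReal
    (|f x - f y| ^ p / dist x y ^ ((d : ℝ) + s * p) * w x * v y)

/-- Membership in `W^{s,p;w,v}(Ω)` for general weights. -/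
def memWgen {d : ℕ} (Ω : Set (Rd d)) (s p : ℝ) (w v f : Rd d → ℝ) : Prop :=
  MemLp f (ENNReal.ofReal p) (volume.restrict Ω) ∧ gagPW Ω s p w v f < ⊤

/-- The norm of `W^{s,p;w,v}(Ω)` (as an extended real). -/
def wNormGen {d : ℕ} (Ω : Set (Rd d)) (s p : ℝ) (w v f : Rd d → ℝ) : ℝ≥0∞ :=
  eLpNorm f (ENNReal.ofReal p) (volume.restrict Ω) + gagPW Ω s p w v f ^ (1 / p)

/-- Membership in `W_0^{s,p;w,v}(Ω)`. -/
def memW0gen {d : ℕ} (Ω : Set (Rd d)) (s p : ℝ) (w v f : Rd d → ℝ) : Prop :=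
  memWgen Ω s p w v f ∧ ∀ ε : ℝ, 0 < ε → ∃ φ : Rd d → ℝ,
    ContDiff ℝ (⊤ : ℕ∞) φ ∧ HasCompactSupport φ ∧ tsupport φ ⊆ Ω ∧ memWgen Ω s p w v φ ∧
    wNormGen Ω s p w v (fun x => f x - φ x) < ENNReal.ofReal ε

/-- Membership in `W_c^{s,p;w,v}(Ω)`: the closure of compactly supported measurable
functions. -/
def memWcgen {d : ℕ} (Ω : Set (Rd d)) (s p : ℝ) (w v f : Rd d → ℝ) : Prop :=
  memWgen Ω s p w v f ∧ ∀ ε : ℝ, 0 < ε → ∃ g : Rd d → ℝ,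
    Measurable g ∧ HasCompactSupport g ∧ tsupport g ⊆ Ω ∧ memWgen Ω s p w v g ∧
    wNormGen Ω s p w v (fun x => f x - g x) < ENNReal.ofReal ε

end


/-- The `p`-th power of the oscillation of `f` between two points. -/
noncomputable def oscPow {X : Type*} (p : ℝ) (f : X → ℝ) (x y : X) : ℝ≥0∞ :=
  ENNReal.ofReal (|f x - f y| ^ p)

theorem oscPow_comm {X : Type*} (p : ℝ) (f : X → ℝ) (x y : X) :
    oscPow p f x y = oscPow p f y x := by
  simp [oscPow, abs_sub_comm]

theorem oscPow_self {X : Type*} {p : ℝ} (hp : 0 < p) (f : X → ℝ) (x : X) :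
    oscPow p f x x = 0 := by
  simp [oscPow, Real.zero_rpow hp.ne']

theorem measurable_oscPow {X : Type*} [MeasurableSpace X] (p : ℝ) {f : X → ℝ}
    (hf : Measurable f) : Measurable (Function.uncurry (oscPow p f)) := by
  unfold oscPow Function.uncurry
  fun_prop

/-- The quasi-triangle inequality for `oscPow`, with first constant arbitrarily close to `1`. -/
theorem exists_oscPow_triangle {p : ℝ} (hp : 0 < p) {a : ℝ} (ha : 1 < a) :
    ∃ b : ℝ≥0∞, b ≠ ⊤ ∧ ∀ {X : Type} (f : X → ℝ) (x y z : X),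
      oscPow p f x z ≤ ENNReal.ofReal a * oscPow p f x y + b * oscPow p f y z := by
  set η := a ^ (1 / p) - 1 with hη
  have h1 : 0 < η := by
    have := Real.one_lt_rpow ha (by positivity : 0 < 1 / p)
    linarith
  have h2 : (1 + η) ^ p = a := by
    rw [hη, add_sub_cancel, ← Real.rpow_mul (by linarith), one_div_mul_cancel hp.ne', Real.rpow_one]
  refine ⟨ENNReal.ofReal ((1 + 1 / η) ^ p), ENNReal.ofReal_ne_top, fun f x y z => ?_⟩
  unfold oscPow
  rw [← ENNReal.ofReal_mul (by linarith), ← ENNReal.ofReal_mul (by positivity),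
    ← ENNReal.ofReal_add (by positivity) (by positivity)]
  apply ENNReal.ofReal_le_ofReal
  have htri : |f x - f z| ≤ |f x - f y| + |f y - f z| := abs_sub_le _ _ _
  have hu := abs_nonneg (f x - f y)
  have hv := abs_nonneg (f y - f z)
  generalize |f x - f y| = u at *
  generalize |f y - f z| = v at *
  refine (Real.rpow_le_rpow (abs_nonneg _) htri hp.le).trans ?_
  rcases le_total v (η * u) with h | h
  · have h3 : (u + v) ^ p ≤ ((1 + η) * u) ^ p :=
      Real.rpow_le_rpow (by positivity) (by linarith) hp.le
    rw [Real.mul_rpow (by positivity) hu, h2] at h3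
    have : 0 ≤ (1 + 1 / η) ^ p * v ^ p := by positivity
    linarith
  · have h4 : u ≤ 1 / η * v := by
      rw [one_div, ← div_eq_inv_mul, le_div_iff₀ h1]; linarith
    have h3 : (u + v) ^ p ≤ ((1 + 1 / η) * v) ^ p :=
      Real.rpow_le_rpow (by positivity) (by linarith) hp.le
    rw [Real.mul_rpow (by positivity) hv] at h3
    have : 0 ≤ a * u ^ p := by positivity
    linarith

/-- The mean of a function of two variables with respect to a pair of measures. -/
noncomputable def pairMean {X : Type*} [MeasurableSpace X] (F : X → X → ℝ≥0∞) (ν₁ ν₂ : Measure X) :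
    ℝ≥0∞ := ∫⁻ x, ∫⁻ y, F x y ∂ν₂ ∂ν₁

theorem pairMean_triangle {X : Type*} [MeasurableSpace X] {F : X → X → ℝ≥0∞}
    (hF : Measurable (Function.uncurry F)) {a b : ℝ≥0∞}
    (h : ∀ x y z, F x z ≤ a * F x y + b * F y z) (ν₁ ν₂ ν₃ : Measure X)
    [IsProbabilityMeasure ν₁] [IsProbabilityMeasure ν₂] [IsProbabilityMeasure ν₃] :
    pairMean F ν₁ ν₃ ≤ a * pairMean F ν₁ ν₂ + b * pairMean F ν₂ ν₃ := by
  have hx : ∀ x, Measurable (F x) := fun x => hF.comp measurable_prodMk_left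
  have hy : ∀ y, Measurable (fun x => F x y) := fun y => hF.comp measurable_prodMk_right
  have h1 : ∀ x z, F x z ≤ a * ∫⁻ y, F x y ∂ν₂ + b * ∫⁻ y, F y z ∂ν₂ := by
    intro x z
    calc F x z = ∫⁻ _, F x z ∂ν₂ := by simp
      _ ≤ ∫⁻ y, a * F x y + b * F y z ∂ν₂ := lintegral_mono fun y => h x y z
      _ = _ := by
        rw [lintegral_add_left ((hx x).const_mul a), lintegral_const_mul _ (hx x),
          lintegral_const_mul _ (hy z)]
  have hm : Measurable fun z => ∫⁻ y, F y z ∂ν₂ := hF.lintegral_prod_left'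
  have hm' : Measurable fun x => ∫⁻ y, F x y ∂ν₂ := hF.lintegral_prod_right'
  have h2 : ∀ x, ∫⁻ z, F x z ∂ν₃ ≤ a * ∫⁻ y, F x y ∂ν₂ + b * pairMean F ν₂ ν₃ := by
    intro x
    calc ∫⁻ z, F x z ∂ν₃ ≤ ∫⁻ z, a * ∫⁻ y, F x y ∂ν₂ + b * ∫⁻ y, F y z ∂ν₂ ∂ν₃ :=
          lintegral_mono fun z => h1 x z
      _ = _ := by
        rw [lintegral_add_left measurable_const, lintegral_const_mul _ hm, lintegral_const,
          measure_univ, mul_one, pairMean, lintegral_lintegral_swap hF.aemeasurable]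
  calc pairMean F ν₁ ν₃ ≤ ∫⁻ x, a * ∫⁻ y, F x y ∂ν₂ + b * pairMean F ν₂ ν₃ ∂ν₁ :=
        lintegral_mono fun x => h2 x
    _ = _ := by
      rw [lintegral_add_right _ measurable_const, lintegral_const_mul _ hm', lintegral_const,
          measure_univ, mul_one]
      rfl

/-- Iterating the quasi-triangle inequality along a chain of bounded length. -/
theorem pairMean_chain_le {X : Type*} [MeasurableSpace X] {F : X → X → ℝ≥0∞}
    (hF : Measurable (Function.uncurry F)) {a : ℝ≥0∞} (ha : 1 ≤ a)
    (h : ∀ x y z, F x z ≤ a * F x y + a * F y z) (ν : ℕ → Measure X)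
    [∀ i, IsProbabilityMeasure (ν i)] {t : ℝ≥0∞} (N : ℕ)
    (hν : ∀ i ≤ N, pairMean F (ν i) (ν (i + 1)) ≤ t) :
    pairMean F (ν 0) (ν (N + 1)) ≤ (2 * a) ^ N * t := by
  induction N with
  | zero => simpa using hν 0 le_rfl
  | succ N ih =>
    have h1 := ih fun i hi => hν i (by omega)
    have h2 := hν (N + 1) le_rfl
    have h3 : 1 ≤ (2 * a) ^ N := one_le_pow₀ (by
      calc (1 : ℝ≥0∞) = 1 * 1 := by simp
        _ ≤ 2 * a := by gcongr; norm_num)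
    calc pairMean F (ν 0) (ν (N + 1 + 1))
        ≤ a * pairMean F (ν 0) (ν (N + 1)) + a * pairMean F (ν (N + 1)) (ν (N + 1 + 1)) :=
          pairMean_triangle hF h _ _ _
      _ ≤ a * ((2 * a) ^ N * t) + a * ((2 * a) ^ N * t) := by
          gcongr
          exact h2.trans (le_mul_of_one_le_left' h3)
      _ = _ := by ring

/-- Iterating the quasi-triangle inequality along a chain of arbitrary length. -/
theorem pairMean_telescope_le {X : Type*} [MeasurableSpace X] {F : X → X → ℝ≥0∞}
    (hF : Measurable (Function.uncurry F)) {a b : ℝ≥0∞}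
    (h : ∀ x y z, F x z ≤ a * F x y + b * F y z) (ν₀ : Measure X) [IsProbabilityMeasure ν₀]
    (ν : ℕ → Measure X) [∀ i, IsProbabilityMeasure (ν i)] (N : ℕ) :
    pairMean F ν₀ (ν 0) ≤ a ^ N * pairMean F ν₀ (ν N) +
      ∑ k ∈ Finset.range N, a ^ k * (b * pairMean F (ν (k + 1)) (ν k)) := by
  induction N with
  | zero => simp
  | succ N ih =>
    refine ih.trans ?_
    rw [Finset.sum_range_succ]
    calc _ ≤ a ^ N * (a * pairMean F ν₀ (ν (N + 1)) + b * pairMean F (ν (N + 1)) (ν N)) +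
          ∑ k ∈ Finset.range N, a ^ k * (b * pairMean F (ν (k + 1)) (ν k)) := by
          gcongr
          exact pairMean_triangle hF h _ _ _
      _ = _ := by ring

theorem distBd_nonneg {d : ℕ} (Ω : Set (Rd d)) (x : Rd d) : 0 ≤ distBd Ω x := infDist_nonneg

theorem distBd_le_add {d : ℕ} (Ω : Set (Rd d)) (x y : Rd d) :
    distBd Ω x ≤ distBd Ω y + dist x y := infDist_le_infDist_add_dist

@[fun_prop]
theorem continuous_distBd {d : ℕ} (Ω : Set (Rd d)) : Continuous (distBd Ω) :=
  continuous_infDist_pt _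

@[fun_prop]
theorem measurable_distBd {d : ℕ} (Ω : Set (Rd d)) : Measurable (distBd Ω) :=
  (continuous_distBd Ω).measurable

theorem distBd_pos {d : ℕ} {Ω : Set (Rd d)} (hΩ : IsOpen Ω) (hfr : (frontier Ω).Nonempty)
    {x : Rd d} (hx : x ∈ Ω) : 0 < distBd Ω x := by
  refine (isClosed_frontier.notMem_iff_infDist_pos hfr).1 fun h => ?_
  rw [hΩ.frontier_eq] at h
  exact h.2 hx

theorem ball_distBd_subset {d : ℕ} {Ω : Set (Rd d)} (hΩ : IsOpen Ω) {x : Rd d} (hx : x ∈ Ω) :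
    ball x (distBd Ω x) ⊆ Ω := by
  rcases (distBd_nonneg Ω x).eq_or_lt with h0 | h0
  · simp [← h0]
  refine (convex_ball _ _).isPreconnected.subset_of_closure_inter_subset hΩ
    ⟨x, mem_ball_self h0, hx⟩ fun y ⟨hy, hyx⟩ => ?_
  by_contra hyΩ
  have : distBd Ω x ≤ dist x y := infDist_le_dist_of_mem (by rw [hΩ.frontier_eq]; exact ⟨hy, hyΩ⟩)
  rw [mem_ball, dist_comm] at hyx
  linarith

theorem volume_ball_rd {d : ℕ} (u : Rd d) {ρ : ℝ} (hρ : 0 < ρ) :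
    volume (ball u ρ) = ENNReal.ofReal (ρ ^ (d : ℝ)) * volume (ball (0 : Rd d) 1) := by
  rw [Measure.addHaar_ball_of_pos _ _ hρ]
  simp

theorem volume_ball_rd_ne_zero {d : ℕ} (u : Rd d) {ρ : ℝ} (hρ : 0 < ρ) : volume (ball u ρ) ≠ 0 :=
  (measure_ball_pos _ _ hρ).ne'

theorem inv_volume_ball_rd {d : ℕ} (u : Rd d) {ρ : ℝ} (hρ : 0 < ρ) :
    (volume (ball u ρ))⁻¹ =
      ENNReal.ofReal (ρ ^ (-(d : ℝ))) * (volume (ball (0 : Rd d) 1))⁻¹ := by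
  rw [volume_ball_rd u hρ, ENNReal.mul_inv (Or.inr measure_ball_lt_top.ne)
    (Or.inl ENNReal.ofReal_ne_top), ← ENNReal.ofReal_inv_of_pos (by positivity),
    Real.rpow_neg hρ.le]

/-- The uniform probability measure on a ball. -/
noncomputable def ballUnif {d : ℕ} (u : Rd d) (ρ : ℝ) : Measure (Rd d) :=
  (volume (ball u ρ))⁻¹ • volume.restrict (ball u ρ)

theorem isProbabilityMeasure_ballUnif {d : ℕ} (u : Rd d) {ρ : ℝ} (hρ : 0 < ρ) :
    IsProbabilityMeasure (ballUnif u ρ) := by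
  constructor
  simp only [ballUnif, Measure.smul_apply, Measure.restrict_apply_univ, smul_eq_mul]
  exact ENNReal.inv_mul_cancel (volume_ball_rd_ne_zero u hρ) measure_ball_lt_top.ne

/-- The integral of `F x` over the ball centred at `x` with radius proportional to the distance
to the boundary. -/
noncomputable def localOsc {d : ℕ} (Ω : Set (Rd d)) (θ : ℝ) (F : Rd d → Rd d → ℝ≥0∞) (x : Rd d) :
    ℝ≥0∞ := ∫⁻ y in ball x (θ * distBd Ω x), F x y

theorem measurable_localOsc {d : ℕ} (Ω : Set (Rd d)) (θ : ℝ) {F : Rd d → Rd d → ℝ≥0∞}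
    (hF : Measurable (Function.uncurry F)) : Measurable (localOsc Ω θ F) := by
  have hS : MeasurableSet {q : Rd d × Rd d | dist q.2 q.1 < θ * distBd Ω q.1} :=
    measurableSet_lt (by fun_prop) (by fun_prop)
  have h : localOsc Ω θ F = fun x => ∫⁻ y,
      {q : Rd d × Rd d | dist q.2 q.1 < θ * distBd Ω q.1}.indicator (Function.uncurry F) (x, y) := by
    ext x
    rw [localOsc, ← lintegral_indicator measurableSet_ball]
    rfl
  rw [h]
  exact (hF.indicator hS).lintegral_prod_right'

theorem pairMean_dirac_ballUnif_le {d : ℕ} {Ω : Set (Rd d)} {θ : ℝ} {F : Rd d → Rd d → ℝ≥0∞}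
    (hF : Measurable (Function.uncurry F)) {x u : Rd d} {ρ : ℝ}
    (h : ball u ρ ⊆ ball x (θ * distBd Ω x)) :
    pairMean F (Measure.dirac x) (ballUnif u ρ) ≤ (volume (ball u ρ))⁻¹ * localOsc Ω θ F x := by
  have hm : Measurable fun a => ∫⁻ y, F a y ∂ballUnif u ρ := by
    unfold ballUnif
    simp only [lintegral_smul_measure]
    exact (hF.lintegral_prod_right' (ν := volume.restrict (ball u ρ))).const_mul _
  rw [pairMean, lintegral_dirac' _ hm, ballUnif, lintegral_smul_measure,
    smul_eq_mul]
  gcongr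
  exact lintegral_mono_set h

theorem pairMean_ballUnif_le {d : ℕ} {Ω : Set (Rd d)} {θ : ℝ} {F : Rd d → Rd d → ℝ≥0∞}
    {u v : Rd d} {ρ ρ' : ℝ} (hθ0 : 0 < θ) (hθ1 : θ ≤ 1) (hρ : 0 < ρ)
    (hρρ' : ρ ≤ ρ') (hρ' : ρ' ≤ 2 * ρ) (huv : dist u v ≤ ρ) (hu : 5 * ρ ≤ θ * distBd Ω u) :
    pairMean F (ballUnif u ρ) (ballUnif v ρ') ≤
      (volume (ball u ρ))⁻¹ * (volume (ball u ρ))⁻¹ * ∫⁻ z in ball u ρ, localOsc Ω θ F z := by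
  have hvol : (volume (ball v ρ'))⁻¹ ≤ (volume (ball u ρ))⁻¹ := by
    rw [ENNReal.inv_le_inv, volume_ball_rd u hρ, volume_ball_rd v (hρ.trans_le hρρ')]
    gcongr
  rw [pairMean, ballUnif, lintegral_smul_measure, smul_eq_mul, mul_assoc]
  gcongr
  rw [← lintegral_const_mul' _ _ (ENNReal.inv_ne_top.2 (volume_ball_rd_ne_zero u hρ))]
  refine setLIntegral_mono' measurableSet_ball fun z hz => ?_
  rw [ballUnif, lintegral_smul_measure, smul_eq_mul]
  gcongr
  refine lintegral_mono_set fun w hw => ?_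
  rw [mem_ball] at *
  have h1 := distBd_le_add Ω u z
  rw [dist_comm] at h1
  have h2 : dist w z ≤ dist w v + dist v u + dist u z := dist_triangle4 _ _ _ _
  rw [dist_comm v u, dist_comm u z] at h2
  nlinarith

/-- The uniformity condition with a fixed constant. -/
def UniformWith {d : ℕ} (Ω : Set (Rd d)) (C : ℝ) : Prop :=
  ∀ x ∈ Ω, ∀ y ∈ Ω, ∃ (l : ℝ) (γ : ℝ → Rd d),
    0 ≤ l ∧ l ≤ C * dist x y ∧ γ 0 = x ∧ γ l = y ∧
    (∀ t ∈ Set.Icc 0 l, γ t ∈ Ω) ∧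
    LipschitzOnWith 1 γ (Set.Icc 0 l) ∧
    ∀ t ∈ Set.Icc 0 l,
      min (dist (γ t) x) (dist (γ t) y) / C ≤ distBd Ω (γ t)

/-- The curve joining two points that are well inside the domain stays well inside. -/
theorem le_distBd_of_min_le {d : ℕ} {Ω : Set (Rd d)} {C r : ℝ} (hC : 1 ≤ C) (hr : 0 < r)
    {u v w : Rd d} (hu : r / C ≤ distBd Ω u) (hv : r / C ≤ distBd Ω v)
    (hw : min (dist w u) (dist w v) / C ≤ distBd Ω w) : r / (2 * C ^ 2) ≤ distBd Ω w := by
  have hC0 : 0 < C := by linarith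
  have hle : r / (2 * C ^ 2) ≤ r / (2 * C) := by
    apply div_le_div_of_nonneg_left hr.le (by positivity); nlinarith
  have hsplit : r / C = r / (2 * C) + r / (2 * C) := by field_simp; ring
  have key : ∀ a, r / C ≤ distBd Ω a → dist w a ≤ r / (2 * C) → r / (2 * C ^ 2) ≤ distBd Ω w := by
    intro a ha hwa
    have := distBd_le_add Ω a w
    rw [dist_comm] at this
    linarith
  rcases le_total (dist w u) (r / (2 * C)) with h | h
  · exact key u hu h
  rcases le_total (dist w v) (r / (2 * C)) with h' | h'
  · exact key v hv h'
  refine le_trans ?_ hw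
  rw [le_div_iff₀ hC0]
  refine le_trans (le_of_eq ?_) (le_min h h')
  field_simp

theorem exists_pairMean_ballUnif_le {d : ℕ} {Ω : Set (Rd d)} (hΩ : IsOpen Ω) {C θ : ℝ} (hC : 1 ≤ C)
    (hU : UniformWith Ω C) (hθ0 : 0 < θ) (hθ1 : θ ≤ 1) {a : ℝ≥0∞} (ha1 : 1 ≤ a) (ha : a ≠ ⊤) :
    ∃ M : ℝ≥0∞, M ≠ ⊤ ∧ ∀ F : Rd d → Rd d → ℝ≥0∞, Measurable (Function.uncurry F) →
      (∀ x y z, F x z ≤ a * F x y + a * F y z) → ∀ u ∈ Ω, ∀ v ∈ Ω, ∀ r : ℝ, 0 < r →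
      dist u v ≤ 9 * r → r / C ≤ distBd Ω u → r / C ≤ distBd Ω v →
      pairMean F (ballUnif u (θ / (10 * C ^ 2) * r)) (ballUnif v (2 * (θ / (10 * C ^ 2) * r))) ≤
        M * ENNReal.ofReal (r ^ (-(2 * d : ℝ))) *
          ∫⁻ z in {z | z ∈ Ω ∧ dist z u ≤ 10 * C * r ∧ r / (4 * C ^ 2) ≤ distBd Ω z},
            localOsc Ω θ F z := by
  have hC0 : 0 < C := by linarith
  set η := θ / (10 * C ^ 2) with hη
  have hη0 : 0 < η := by positivity
  obtain ⟨N, hN⟩ := exists_nat_gt (9 * C / η)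
  have hN0 : (0 : ℝ) < N := lt_trans (by positivity) hN
  refine ⟨(2 * a) ^ N * ((ENNReal.ofReal (η ^ (-(d : ℝ))) * (volume (ball (0 : Rd d) 1))⁻¹) *
    (ENNReal.ofReal (η ^ (-(d : ℝ))) * (volume (ball (0 : Rd d) 1))⁻¹)), ?_, ?_⟩
  · have := ENNReal.inv_ne_top.2 (volume_ball_rd_ne_zero (0 : Rd d) one_pos)
    finiteness
  intro F hF hquasi u hu v hv r hr huv hru hrv
  obtain ⟨l, γ, hl0, hl, hγ0, hγl, hγΩ, hγlip, hγδ⟩ := hU u hu v hv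
  have hlr : l ≤ 9 * C * r := hl.trans (by nlinarith)
  set ρ := η * r with hρ
  have hρ0 : 0 < ρ := by positivity
  have hstep : l / N ≤ ρ := by
    rw [div_le_iff₀ hN0]
    rw [div_lt_iff₀ hη0] at hN
    calc l ≤ 9 * C * r := hlr
      _ ≤ (N * η) * r := by gcongr
      _ = ρ * N := by rw [hρ]; ring
  set t : ℕ → ℝ := fun i => min (i * (l / N)) l with ht
  have htmem : ∀ i, t i ∈ Icc 0 l := fun i => ⟨le_min (by positivity) hl0, min_le_right _ _⟩
  have ht0 : t 0 = 0 := by simp [ht, hl0]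
  have htN : ∀ i, N ≤ i → t i = l := by
    intro i hi
    apply min_eq_right
    have : (N : ℝ) ≤ i := by exact_mod_cast hi
    calc l = N * (l / N) := by field_simp
      _ ≤ _ := by gcongr
  have htstep : ∀ i, |t i - t (i + 1)| ≤ ρ := by
    intro i
    refine (abs_min_sub_min_le_max _ _ _ _).trans (max_le ?_ (by simpa using hρ0.le))
    push_cast
    rw [show (i : ℝ) * (l / N) - (i + 1) * (l / N) = -(l / N) by ring, abs_neg,
      abs_of_nonneg (by positivity)]
    exact hstep
  have hδ : ∀ i, r / (2 * C ^ 2) ≤ distBd Ω (γ (t i)) := fun i =>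
    le_distBd_of_min_le hC hr hru hrv (hγδ _ (htmem i))
  have hlip : ∀ s ∈ Icc 0 l, ∀ s' ∈ Icc 0 l, dist (γ s) (γ s') ≤ |s - s'| := by
    intro s hs s' hs'
    simpa [Real.dist_eq] using hγlip.dist_le_mul s hs s' hs'
  set ν : ℕ → Measure (Rd d) := fun i => ballUnif (γ (t i)) (if i ≤ N then ρ else 2 * ρ) with hν
  have hprob : ∀ i, IsProbabilityMeasure (ν i) := by
    intro i
    apply isProbabilityMeasure_ballUnif
    split_ifs <;> positivity
  set I := ∫⁻ z in {z | z ∈ Ω ∧ dist z u ≤ 10 * C * r ∧ r / (4 * C ^ 2) ≤ distBd Ω z},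
            localOsc Ω θ F z with hI
  have hball : ∀ i, ball (γ (t i)) ρ ⊆
      {z | z ∈ Ω ∧ dist z u ≤ 10 * C * r ∧ r / (4 * C ^ 2) ≤ distBd Ω z} := by
    intro i z hz
    rw [mem_ball] at hz
    have hri : r / (2 * C ^ 2) = 5 * (r / (10 * C ^ 2)) := by field_simp; norm_num
    have hρr : ρ ≤ r / (10 * C ^ 2) := by
      rw [hρ, hη, div_mul_eq_mul_div]
      gcongr
      nlinarith
    have hρr' : r / (10 * C ^ 2) ≤ r := div_le_self hr.le (by nlinarith)
    have hr4 : r / (4 * C ^ 2) = 5 / 2 * (r / (10 * C ^ 2)) := by field_simp; norm_num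
    have h0 : 0 < r / (10 * C ^ 2) := by positivity
    have h1 := hδ i
    refine ⟨ball_distBd_subset hΩ (hγΩ _ (htmem i)) ?_, ?_, ?_⟩
    · rw [mem_ball]; linarith
    · have h2 := hlip _ (htmem i) 0 ⟨le_rfl, hl0⟩
      rw [hγ0, sub_zero, abs_of_nonneg (htmem i).1] at h2
      have h3 := dist_triangle z (γ (t i)) u
      have h4 := (htmem i).2
      nlinarith
    · have h2 := distBd_le_add Ω (γ (t i)) z
      rw [dist_comm] at h2
      linarith
  have hpair : ∀ i ≤ N, pairMean F (ν i) (ν (i + 1)) ≤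
      (volume (ball (γ (t i)) ρ))⁻¹ * (volume (ball (γ (t i)) ρ))⁻¹ * I := by
    intro i hi
    simp only [hν, if_pos hi]
    refine (pairMean_ballUnif_le (Ω := Ω) hθ0 hθ1 hρ0 ?_ ?_ ?_ ?_).trans ?_
    · split_ifs <;> linarith
    · split_ifs <;> linarith
    · exact (hlip _ (htmem i) _ (htmem _)).trans (htstep i)
    · have h1 := mul_le_mul_of_nonneg_left (hδ i) hθ0.le
      refine le_trans (le_of_eq ?_) h1
      rw [hρ, hη]
      field_simp
      norm_num
    · gcongr
      exact lintegral_mono_set (hball i)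
  have hmain := pairMean_chain_le hF ha1 hquasi ν (t := (volume (ball (0 : Rd d) ρ))⁻¹ *
    (volume (ball (0 : Rd d) ρ))⁻¹ * I) N (fun i hi => by
      refine (hpair i hi).trans (le_of_eq ?_)
      rw [inv_volume_ball_rd _ hρ0, inv_volume_ball_rd _ hρ0])
  simp only [hν, ht0, hγ0, htN (N + 1) (by omega), hγl, zero_le, if_true,
    if_neg (show ¬ N + 1 ≤ N by omega)] at hmain
  refine hmain.trans (le_of_eq ?_)
  rw [inv_volume_ball_rd _ hρ0, hρ, Real.mul_rpow hη0.le hr.le,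
    ENNReal.ofReal_mul (by positivity), show (-(2 * d : ℝ)) = -(d : ℝ) + -(d : ℝ) by ring,
    Real.rpow_add hr, ENNReal.ofReal_mul (p := r ^ (-(d : ℝ))) (by positivity)]
  ring

theorem exists_card_dyadic_scales_le {a b : ℝ} (ha : 0 < a) :
    ∃ m : ℕ, ∀ R t : ℝ, 0 < R → ∀ K : ℕ,
      ((Finset.range K).filter fun k => a * (R / 2 ^ (k + 2)) ≤ t ∧ t ≤ b * (R / 2 ^ (k + 2))).card
        ≤ m := by
  obtain ⟨m, hm⟩ := pow_unbounded_of_one_lt (b / a) (one_lt_two (α := ℝ))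
  refine ⟨m, fun R t hR K => ?_⟩
  set s := (Finset.range K).filter fun k =>
    a * (R / 2 ^ (k + 2)) ≤ t ∧ t ≤ b * (R / 2 ^ (k + 2)) with hs
  rcases s.eq_empty_or_nonempty with h0 | h0
  · simp [h0]
  have hsub : s ⊆ Finset.Ico (s.min' h0) (s.min' h0 + m) := by
    intro k hk
    rw [Finset.mem_Ico]
    refine ⟨s.min'_le k hk, ?_⟩
    have h1 := (Finset.mem_filter.1 (s.min'_mem h0)).2.1
    have h2 := (Finset.mem_filter.1 hk).2.2
    by_contra! hlt
    generalize s.min' h0 = k₀ at *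
    obtain ⟨j, rfl⟩ := Nat.exists_eq_add_of_le hlt
    have h3 := h1.trans h2
    rw [div_lt_iff₀ ha] at hm
    have h4 : b * (R / 2 ^ (k₀ + m + j + 2)) < a * (R / 2 ^ (k₀ + 2)) := by
      rw [show k₀ + m + j + 2 = (k₀ + 2) + (m + j) by ring, pow_add _ (k₀ + 2), ← div_div,
        ← mul_div_assoc, div_lt_iff₀ (by positivity)]
      have h5 : (2 : ℝ) ^ m ≤ 2 ^ (m + j) := pow_le_pow_right₀ (by norm_num) (by omega)
      have h6 : 0 < R / 2 ^ (k₀ + 2) := by positivity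
      calc b * (R / 2 ^ (k₀ + 2)) < 2 ^ m * a * (R / 2 ^ (k₀ + 2)) := by gcongr
        _ ≤ 2 ^ (m + j) * a * (R / 2 ^ (k₀ + 2)) := by gcongr
        _ = _ := by ring
    linarith
  exact (Finset.card_le_card hsub).trans (by simp)

theorem rpow_scale_le {r t c R ε q A : ℝ} (hr : 0 < r) (ht : 0 < t) (htr : t ≤ c * r) (hR : 0 < R)
    (hε : 0 ≤ ε) (hq : 0 ≤ q) (hA0 : 0 ≤ A) (hA : A ≤ R / r) :
    A ^ ε * r ^ (-q) ≤ c ^ (q + ε) * (R ^ ε * t ^ (-(q + ε))) := by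
  have hc : 0 < c := by
    by_contra! h
    nlinarith
  have h1 : A ^ ε * r ^ (-q) ≤ R ^ ε * r ^ (-(q + ε)) := by
    calc A ^ ε * r ^ (-q) ≤ (R / r) ^ ε * r ^ (-q) := by gcongr
      _ = _ := by
        rw [Real.div_rpow hR.le hr.le, neg_add, Real.rpow_add hr, Real.rpow_neg hr.le ε]
        ring
  have h2 : r ^ (-(q + ε)) ≤ (t / c) ^ (-(q + ε)) := by
    apply Real.rpow_le_rpow_of_nonpos (by positivity) _ (by linarith)
    rw [div_le_iff₀ hc]; linarith
  rw [Real.div_rpow ht.le hc.le, Real.rpow_neg hc.le, div_inv_eq_mul] at h2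
  calc A ^ ε * r ^ (-q) ≤ R ^ ε * r ^ (-(q + ε)) := h1
    _ ≤ R ^ ε * (t ^ (-(q + ε)) * c ^ (q + ε)) := by gcongr
    _ = _ := by ring

/-- A bound for the oscillation of a function from a point `x` up to scale `R` in terms of its local
oscillations. -/
noncomputable def chainBound {d : ℕ} (Ω : Set (Rd d)) (ε B : ℝ) (O : Rd d → ℝ≥0∞) (x : Rd d)
    (R : ℝ) : ℝ≥0∞ :=
  ENNReal.ofReal (R ^ ε) * (ENNReal.ofReal (distBd Ω x ^ (-(d + ε))) * O x +
    ∫⁻ z in {z | z ∈ Ω ∧ dist z x ≤ B * distBd Ω z ∧ distBd Ω z ≤ B * R},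
      ENNReal.ofReal (distBd Ω z ^ (-(2 * d + ε))) * O z)

/-- If each point lies in at most `m` of the sets `S k`, then the integrals over these sets add up
to at most `m` times the integral over a set containing them. -/
theorem sum_setLIntegral_le {X : Type*} [MeasurableSpace X] {μ : Measure X} (K m : ℕ)
    {S : ℕ → Set X} {T : Set X} (hS : ∀ k, MeasurableSet (S k)) (hT : MeasurableSet T)
    (hST : ∀ k < K, S k ⊆ T) {P : X → ℕ → Prop} [∀ x, DecidablePred (P x)]
    (hP : ∀ k < K, ∀ x ∈ S k, P x k)
    (hcard : ∀ x, ((Finset.range K).filter (P x)).card ≤ m) {g : X → ℝ≥0∞} (hg : Measurable g) :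
    ∑ k ∈ Finset.range K, ∫⁻ x in S k, g x ∂μ ≤ m * ∫⁻ x in T, g x ∂μ := by
  simp only [← lintegral_indicator (hS _), ← lintegral_indicator hT]
  rw [← lintegral_finsetSum _ fun k _ => hg.indicator (hS k),
    ← lintegral_const_mul _ (hg.indicator hT)]
  refine lintegral_mono fun x => ?_
  calc ∑ k ∈ Finset.range K, (S k).indicator g x
      ≤ ∑ k ∈ Finset.range K, if P x k then T.indicator g x else 0 := by
        refine Finset.sum_le_sum fun k hk => ?_
        rw [Finset.mem_range] at hk
        by_cases hx : x ∈ S k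
        · rw [if_pos (hP k hk x hx), indicator_of_mem hx, indicator_of_mem (hST k hk hx)]
        · simp [hx]
    _ = ((Finset.range K).filter (P x)).card * T.indicator g x := by
        rw [← Finset.sum_filter, Finset.sum_const, nsmul_eq_mul]
    _ ≤ m * T.indicator g x := by gcongr; exact hcard x

theorem exists_pairMean_dirac_ballUnif_le {d : ℕ} {Ω : Set (Rd d)} (hΩ : IsOpen Ω)
    (hfr : (frontier Ω).Nonempty) {C θ ε : ℝ} (hC : 1 ≤ C)
    (hU : UniformWith Ω C) (hθ0 : 0 < θ) (hθ1 : θ ≤ 1) (hε : 0 < ε) {L b : ℝ≥0∞} (hL1 : 1 ≤ L)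
    (hL : L ≠ ⊤) (hb : b ≠ ⊤) :
    ∃ (M : ℝ≥0∞) (B : ℝ), M ≠ ⊤ ∧ 1 ≤ B ∧ ∀ F : Rd d → Rd d → ℝ≥0∞,
      Measurable (Function.uncurry F) → (∀ x y z, F x z ≤ L * F x y + L * F y z) →
      (∀ x y z, F x z ≤ ENNReal.ofReal (2 ^ ε) * F x y + b * F y z) →
      ∀ x ∈ Ω, ∀ R : ℝ, 0 < R → θ / 2 * distBd Ω x ≤ R → ∀ c : ℕ → Rd d,
      (∀ k, c k ∈ Ω) → (∀ k, dist (c k) x ≤ 3 * (R / 2 ^ (k + 1))) →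
      (∀ k, R / 2 ^ (k + 1) / C ≤ distBd Ω (c k)) →
      pairMean F (Measure.dirac x) (ballUnif (c 0) (θ / (10 * C ^ 2) * (R / 2))) ≤
        M * chainBound Ω ε B (localOsc Ω θ F) x R := by
  have hC0 : 0 < C := by linarith
  obtain ⟨M₀, hM₀, hconn⟩ := exists_pairMean_ballUnif_le hΩ hC hU hθ0 hθ1 hL1 hL
  obtain ⟨m, hm⟩ := exists_card_dyadic_scales_le (a := 1 / (4 * C ^ 2)) (b := 21 * C / θ)
    (by positivity)
  set η := θ / (10 * C ^ 2) with hη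
  have hη0 : 0 < η := by positivity
  have hη1 : η < 1 := by
    rw [hη, div_lt_one (by positivity)]; nlinarith
  set M₁ : ℝ≥0∞ := ENNReal.ofReal (η ^ (-(d : ℝ))) * (volume (ball (0 : Rd d) 1))⁻¹ *
    ENNReal.ofReal ((8 / θ) ^ (d + ε)) with hM₁
  set M₂ : ℝ≥0∞ := b * M₀ * ENNReal.ofReal ((21 * C / θ) ^ (2 * d + ε)) * m with hM₂
  set B : ℝ := 52 * C ^ 3 + 21 * C / θ with hB
  refine ⟨M₁ + M₂, B, ?_, ?_, ?_⟩
  · have := ENNReal.inv_ne_top.2 (volume_ball_rd_ne_zero (0 : Rd d) one_pos)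
    finiteness
  · have h1 : 0 < 21 * C / θ := by positivity
    have h2 : 1 ≤ C ^ 3 := one_le_pow₀ hC
    linarith
  intro F hF hquasi hquasi' x hx R hR hRx c hcΩ hcx hcδ
  have hδx : 0 < distBd Ω x := distBd_pos hΩ hfr hx
  set r : ℕ → ℝ := fun k => R / 2 ^ (k + 1) with hr
  have hr0 : ∀ k, 0 < r k := fun k => by simp only [hr]; positivity
  have hrsucc : ∀ k, r k = 2 * r (k + 1) := fun k => by
    simp only [hr]; rw [pow_succ _ (k + 1)]; field_simp
  have hranti : Antitone r := antitone_nat_of_succ_le fun k => by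
    have := hrsucc k; have := hr0 (k + 1); linarith
  have hex : ∃ k, 4 * r k ≤ θ * distBd Ω x := by
    obtain ⟨n, hn⟩ := pow_unbounded_of_one_lt (4 * R / (θ * distBd Ω x)) (one_lt_two (α := ℝ))
    refine ⟨n, ?_⟩
    rw [div_lt_iff₀ (by positivity)] at hn
    simp only [hr]
    rw [← mul_div_assoc, div_le_iff₀ (by positivity), pow_succ]
    have : 0 < 2 ^ n * (θ * distBd Ω x) := by positivity
    linarith
  classical
  set K := Nat.find hex with hK
  have hK1 : 4 * r K ≤ θ * distBd Ω x := Nat.find_spec hex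
  have hK2 : distBd Ω x ≤ 8 / θ * r K := by
    rw [div_mul_eq_mul_div, le_div_iff₀ hθ0]
    rcases Nat.eq_zero_or_pos K with h0 | h0
    · rw [h0]
      simp only [hr, zero_add, pow_one]
      linarith
    · obtain ⟨j, hj⟩ := Nat.exists_eq_succ_of_ne_zero h0.ne'
      have := Nat.find_min hex (m := j) (by omega)
      rw [hj]
      have h3 := hrsucc j
      push Not at this
      simp only [Nat.succ_eq_add_one]
      linarith
  set ν : ℕ → Measure (Rd d) := fun k => ballUnif (c k) (η * r k) with hν
  have hprob : ∀ i, IsProbabilityMeasure (ν i) := fun i =>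
    isProbabilityMeasure_ballUnif _ (mul_pos hη0 (hr0 i))
  have htel := pairMean_telescope_le hF hquasi' (Measure.dirac x) ν K
  have hpow : ∀ k : ℕ, ENNReal.ofReal (2 ^ ε) ^ k = ENNReal.ofReal ((2 ^ k) ^ ε) := by
    intro k
    rw [← ENNReal.ofReal_pow (by positivity), ← Real.rpow_natCast, ← Real.rpow_natCast,
      ← Real.rpow_mul (by norm_num), ← Real.rpow_mul (by norm_num), mul_comm]
  have hν0 : ν 0 = ballUnif (c 0) (η * (R / 2)) := by simp [hν, hr]
  rw [← hν0]
  set O := localOsc Ω θ F with hO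
  have hOm : Measurable O := measurable_localOsc Ω θ hF
  have hfirst : ENNReal.ofReal (2 ^ ε) ^ K * pairMean F (Measure.dirac x) (ν K) ≤
      M₁ * (ENNReal.ofReal (R ^ ε) * (ENNReal.ofReal (distBd Ω x ^ (-(d + ε))) * O x)) := by
    have h1 : pairMean F (Measure.dirac x) (ν K) ≤ (volume (ball (c K) (η * r K)))⁻¹ * O x := by
      apply pairMean_dirac_ballUnif_le hF
      apply ball_subset_ball'
      have := hcx K
      have h2 := hr0 K
      have h3 : η * r K < r K := by nlinarith
      simp only [hr] at *
      linarith
    have h2 : (2 ^ K : ℝ) ≤ R / r K := by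
      simp only [hr]
      rw [div_div_cancel₀ hR.ne', pow_succ]
      have : (0 : ℝ) < 2 ^ K := by positivity
      linarith
    have h3 := rpow_scale_le (hr0 K) hδx hK2 hR hε.le (Nat.cast_nonneg d) (by positivity) h2
    have h4 := ENNReal.ofReal_le_ofReal h3
    rw [ENNReal.ofReal_mul (by positivity), ENNReal.ofReal_mul (by positivity),
      ENNReal.ofReal_mul (p := R ^ ε) (by positivity)] at h4
    calc _ ≤ ENNReal.ofReal (2 ^ ε) ^ K * ((volume (ball (c K) (η * r K)))⁻¹ * O x) := by gcongr
      _ = (ENNReal.ofReal (η ^ (-(d : ℝ))) * (volume (ball (0 : Rd d) 1))⁻¹) *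
          (ENNReal.ofReal ((2 ^ K) ^ ε) * ENNReal.ofReal (r K ^ (-(d : ℝ)))) * O x := by
        rw [hpow, inv_volume_ball_rd _ (mul_pos hη0 (hr0 K)), Real.mul_rpow hη0.le (hr0 K).le,
          ENNReal.ofReal_mul (by positivity)]
        ring
      _ ≤ _ := by
        grw [h4]
        apply le_of_eq
        rw [hM₁]
        ring
  set T : Set (Rd d) := {z | z ∈ Ω ∧ dist z x ≤ B * distBd Ω z ∧ distBd Ω z ≤ B * R} with hT
  have hTm : MeasurableSet T := by
    have h1 : Measurable fun z => dist z x := by fun_prop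
    exact hΩ.measurableSet.inter
      ((measurableSet_le h1 ((measurable_distBd Ω).const_mul B)).inter
        (measurableSet_le (measurable_distBd Ω) measurable_const))
  set S : ℕ → Set (Rd d) := fun k => {z | z ∈ Ω ∧ dist z (c (k + 1)) ≤ 10 * C * r (k + 1) ∧
    r (k + 1) / (4 * C ^ 2) ≤ distBd Ω z} with hS
  have hSm : ∀ k, MeasurableSet (S k) := fun k => by
    have h1 : Measurable fun z => dist z (c (k + 1)) := by fun_prop
    exact hΩ.measurableSet.inter ((measurableSet_le h1 measurable_const).inter
      (measurableSet_le measurable_const (measurable_distBd Ω)))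
  set g : Rd d → ℝ≥0∞ := fun z => ENNReal.ofReal (distBd Ω z ^ (-(2 * d + ε))) * O z with hg
  have hgm : Measurable g := by fun_prop
  have hSx : ∀ k, ∀ z ∈ S k, dist z x ≤ 13 * C * r (k + 1) := by
    intro k z hz
    have h1 := dist_triangle z (c (k + 1)) x
    have h2 := hcx (k + 1)
    have h3 := hz.2.1
    have h4 := hr0 (k + 1)
    simp only [hr] at *
    nlinarith
  have hSδ : ∀ k < K, ∀ z ∈ S k, distBd Ω z ≤ 21 * C / θ * r (k + 1) := by
    intro k hk z hz
    have h1 := hSx k z hz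
    have h2 := distBd_le_add Ω z x
    have h3 : r K ≤ r (k + 1) := hranti (by omega)
    have h4 : 8 / θ * r K ≤ 8 / θ * r (k + 1) := by gcongr
    have h5 : 0 < r (k + 1) := hr0 _
    have h6 : 8 / θ ≤ 8 * C / θ := by gcongr; linarith
    have h7 : 13 * C ≤ 13 * C / θ := by
      rw [le_div_iff₀ hθ0]; nlinarith
    calc distBd Ω z ≤ 8 / θ * r (k + 1) + 13 * C * r (k + 1) := by linarith
      _ ≤ 8 * C / θ * r (k + 1) + 13 * C / θ * r (k + 1) := by gcongr
      _ = _ := by ring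
  have hterm : ∀ k < K, ENNReal.ofReal (2 ^ ε) ^ k * (b * pairMean F (ν (k + 1)) (ν k)) ≤
      (b * M₀ * ENNReal.ofReal ((21 * C / θ) ^ (2 * d + ε))) * ENNReal.ofReal (R ^ ε) *
        ∫⁻ z in S k, g z := by
    intro k hk
    have h1 : pairMean F (ν (k + 1)) (ν k) ≤
        M₀ * ENNReal.ofReal (r (k + 1) ^ (-(2 * d : ℝ))) * ∫⁻ z in S k, O z := by
      have h2 : η * r k = 2 * (η * r (k + 1)) := by rw [hrsucc k]; ring
      simp only [hν, h2]
      refine hconn F hF hquasi _ (hcΩ _) _ (hcΩ _) _ (hr0 _) ?_ (hcδ _) ?_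
      · have h3 := dist_triangle_right (c (k + 1)) (c k) x
        have h4 := hcx (k + 1)
        have h5 := hcx k
        have h6 := hrsucc k
        simp only [hr] at *
        linarith
      · refine le_trans ?_ (hcδ k)
        have h6 := hrsucc k
        have h7 := hr0 (k + 1)
        exact div_le_div_of_nonneg_right (by linarith) hC0.le
    have h2 : ENNReal.ofReal ((2 ^ k) ^ ε) * ENNReal.ofReal (r (k + 1) ^ (-(2 * d : ℝ))) *
        ∫⁻ z in S k, O z ≤ ENNReal.ofReal ((21 * C / θ) ^ (2 * d + ε)) * ENNReal.ofReal (R ^ ε) *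
        ∫⁻ z in S k, g z := by
      rw [← lintegral_const_mul _ hOm, ← lintegral_const_mul _ hgm]
      refine setLIntegral_mono' (hSm k) fun z hz => ?_
      have h3 : (2 ^ k : ℝ) ≤ R / r (k + 1) := by
        simp only [hr]
        rw [div_div_cancel₀ hR.ne']
        exact pow_le_pow_right₀ (by norm_num) (by omega)
      have h4 := rpow_scale_le (hr0 (k + 1)) (distBd_pos hΩ hfr hz.1) (hSδ k hk z hz) hR hε.le
        (by positivity : (0 : ℝ) ≤ 2 * d) (by positivity) h3
      have h5 := ENNReal.ofReal_le_ofReal h4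
      rw [ENNReal.ofReal_mul (by positivity), ENNReal.ofReal_mul (by positivity),
        ENNReal.ofReal_mul (p := R ^ ε) (by positivity)] at h5
      grw [h5]
      simp only [hg]
      apply le_of_eq
      ring
    calc _ ≤ ENNReal.ofReal (2 ^ ε) ^ k * (b *
          (M₀ * ENNReal.ofReal (r (k + 1) ^ (-(2 * d : ℝ))) * ∫⁻ z in S k, O z)) := by gcongr
      _ = b * M₀ * (ENNReal.ofReal ((2 ^ k) ^ ε) * ENNReal.ofReal (r (k + 1) ^ (-(2 * d : ℝ))) *
        ∫⁻ z in S k, O z) := by rw [hpow]; ring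
      _ ≤ _ := by
        grw [h2]
        apply le_of_eq
        ring
  have hsum : ∑ k ∈ Finset.range K, ∫⁻ z in S k, g z ≤ m * ∫⁻ z in T, g z := by
    refine sum_setLIntegral_le K m hSm hTm ?_ (P := fun z k => 1 / (4 * C ^ 2) * (R / 2 ^ (k + 2)) ≤
      distBd Ω z ∧ distBd Ω z ≤ 21 * C / θ * (R / 2 ^ (k + 2))) ?_ (fun z => hm R _ hR K) hgm
    · intro k hk z hz
      have h1 := hSx k z hz
      have h2 := hz.2.2
      have h3 := hSδ k hk z hz
      have h4 : r (k + 1) ≤ R := div_le_self hR.le (one_le_pow₀ (by norm_num))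
      have h5 : 0 < 21 * C / θ := by positivity
      have h6 : 0 < C ^ 3 := by positivity
      have h7 := distBd_nonneg Ω z
      refine ⟨hz.1, ?_, ?_⟩
      · rw [div_le_iff₀ (by positivity)] at h2
        calc dist z x ≤ 13 * C * r (k + 1) := h1
          _ ≤ 13 * C * (distBd Ω z * (4 * C ^ 2)) := by gcongr
          _ = 52 * C ^ 3 * distBd Ω z := by ring
          _ ≤ B * distBd Ω z := by gcongr; linarith
      · calc distBd Ω z ≤ 21 * C / θ * r (k + 1) := h3
          _ ≤ B * R := by
            gcongr
            linarith
    · intro k hk z hz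
      have h2 := hz.2.2
      have h3 := hSδ k hk z hz
      refine ⟨?_, h3⟩
      rw [one_div, ← div_eq_inv_mul]
      exact h2
  refine htel.trans ?_
  rw [chainBound, mul_add (ENNReal.ofReal (R ^ ε)), add_mul M₁]
  calc _ ≤ M₁ * (ENNReal.ofReal (R ^ ε) * (ENNReal.ofReal (distBd Ω x ^ (-(d + ε))) * O x)) +
      ∑ k ∈ Finset.range K, (b * M₀ * ENNReal.ofReal ((21 * C / θ) ^ (2 * d + ε))) *
        ENNReal.ofReal (R ^ ε) * ∫⁻ z in S k, g z := by
        exact add_le_add hfirst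
          (Finset.sum_le_sum fun k hk => hterm k (Finset.mem_range.1 hk))
    _ ≤ M₁ * (ENNReal.ofReal (R ^ ε) * (ENNReal.ofReal (distBd Ω x ^ (-(d + ε))) * O x)) +
        (b * M₀ * ENNReal.ofReal ((21 * C / θ) ^ (2 * d + ε))) *
        ENNReal.ofReal (R ^ ε) * (m * ∫⁻ z in T, g z) := by
        rw [← Finset.mul_sum]
        gcongr
    _ = M₁ * (ENNReal.ofReal (R ^ ε) * (ENNReal.ofReal (distBd Ω x ^ (-(d + ε))) * O x)) +
        M₂ * (ENNReal.ofReal (R ^ ε) * ∫⁻ z in T, g z) := by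
        rw [hM₂]; ring
    _ ≤ _ := by
        gcongr
        · exact le_self_add
        · exact le_add_self

theorem pairMean_comm {X : Type*} [MeasurableSpace X] {F : X → X → ℝ≥0∞}
    (hF : Measurable (Function.uncurry F)) (h : ∀ x y, F x y = F y x) (ν₁ ν₂ : Measure X)
    [SFinite ν₁] [SFinite ν₂] : pairMean F ν₁ ν₂ = pairMean F ν₂ ν₁ := by
  rw [pairMean, lintegral_lintegral_swap hF.aemeasurable, pairMean]
  simp only [h]

theorem pairMean_dirac_dirac {X : Type*} [MeasurableSpace X] {F : X → X → ℝ≥0∞}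
    (hF : Measurable (Function.uncurry F)) (x y : X) :
    pairMean F (Measure.dirac x) (Measure.dirac y) = F x y := by
  have h : ∀ z, ∫⁻ w, F z w ∂(Measure.dirac y) = F z y := fun z =>
    lintegral_dirac' _ (hF.comp measurable_prodMk_left)
  simp only [pairMean, h]
  exact lintegral_dirac' _ (hF.comp measurable_prodMk_right)

theorem exists_le_chainBound_add {d : ℕ} {Ω : Set (Rd d)} (hΩ : IsOpen Ω)
    (hfr : (frontier Ω).Nonempty) {C θ ε : ℝ} (hC : 1 ≤ C)
    (hU : UniformWith Ω C) (hθ0 : 0 < θ) (hθ1 : θ ≤ 1) (hε : 0 < ε) {L b : ℝ≥0∞} (hL1 : 1 ≤ L)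
    (hL : L ≠ ⊤) (hb : b ≠ ⊤) :
    ∃ (M : ℝ≥0∞) (B : ℝ), M ≠ ⊤ ∧ 1 ≤ B ∧ ∀ F : Rd d → Rd d → ℝ≥0∞,
      Measurable (Function.uncurry F) → (∀ x y, F x y = F y x) →
      (∀ x y z, F x z ≤ L * F x y + L * F y z) →
      (∀ x y z, F x z ≤ ENNReal.ofReal (2 ^ ε) * F x y + b * F y z) →
      ∀ x ∈ Ω, ∀ y ∈ Ω, θ / 2 * distBd Ω x ≤ dist x y → θ / 2 * distBd Ω y ≤ dist x y →
      F x y ≤ M * (chainBound Ω ε B (localOsc Ω θ F) x (dist x y) +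
        chainBound Ω ε B (localOsc Ω θ F) y (dist x y)) := by
  have hC0 : 0 < C := by linarith
  obtain ⟨M, B, hM, hB, hmain⟩ := exists_pairMean_dirac_ballUnif_le hΩ hfr hC hU hθ0 hθ1 hε hL1 hL hb
  refine ⟨L * M, B, by finiteness, hB, ?_⟩
  intro F hF hsymm hquasi hquasi' x hx y hy hxR hyR
  have hR : 0 < dist x y := lt_of_lt_of_le (by have := distBd_pos hΩ hfr hx; positivity) hxR
  set R := dist x y with hRdef
  have hhalf : ∀ k : ℕ, 0 < R / 2 ^ (k + 1) ∧ R / 2 ^ (k + 1) ≤ R / 2 := by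
    intro k
    refine ⟨by positivity, ?_⟩
    apply div_le_div_of_nonneg_left hR.le (by norm_num)
    calc (2 : ℝ) = 2 ^ 1 := by norm_num
      _ ≤ _ := pow_le_pow_right₀ (by norm_num) (by omega)
  obtain ⟨l, γ, hl0, -, hγ0, hγl, hγΩ, hγlip, hγδ⟩ := hU x hx y hy
  have h0 : (0 : ℝ) ∈ Icc 0 l := ⟨le_rfl, hl0⟩
  have h1 : l ∈ Icc 0 l := ⟨hl0, le_rfl⟩
  have hpx : ∀ k : ℕ, ∃ c ∈ Ω, dist c x = R / 2 ^ (k + 1) ∧ R / 2 ^ (k + 1) / C ≤ distBd Ω c := by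
    intro k
    have hcont : ContinuousOn (fun t => dist (γ t) x) (Icc 0 l) :=
      (continuous_id.dist continuous_const).comp_continuousOn hγlip.continuousOn
    obtain ⟨t, ht, htk⟩ := isPreconnected_Icc.intermediate_value h0 h1 hcont
      (show R / 2 ^ (k + 1) ∈ Icc (dist (γ 0) x) (dist (γ l) x) by
        rw [hγ0, hγl, dist_self, dist_comm y x]
        exact ⟨(hhalf k).1.le, by linarith [(hhalf k).2]⟩)
    refine ⟨γ t, hγΩ t ht, htk, le_trans ?_ (hγδ t ht)⟩
    have htk' : dist (γ t) x = R / 2 ^ (k + 1) := htk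
    gcongr
    refine le_min htk'.ge ?_
    have := dist_triangle_left x y (γ t)
    linarith [(hhalf k).2]
  have hpy : ∀ k : ℕ, ∃ c ∈ Ω, dist c y = R / 2 ^ (k + 1) ∧ R / 2 ^ (k + 1) / C ≤ distBd Ω c := by
    intro k
    have hcont : ContinuousOn (fun t => dist (γ t) y) (Icc 0 l) :=
      (continuous_id.dist continuous_const).comp_continuousOn hγlip.continuousOn
    obtain ⟨t, ht, htk⟩ := isPreconnected_Icc.intermediate_value h1 h0 hcont
      (show R / 2 ^ (k + 1) ∈ Icc (dist (γ l) y) (dist (γ 0) y) by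
        rw [hγ0, hγl, dist_self]
        exact ⟨(hhalf k).1.le, by linarith [(hhalf k).2]⟩)
    refine ⟨γ t, hγΩ t ht, htk, le_trans ?_ (hγδ t ht)⟩
    have htk' : dist (γ t) y = R / 2 ^ (k + 1) := htk
    gcongr
    refine le_min ?_ htk'.ge
    have := dist_triangle_left x y (γ t)
    linarith [(hhalf k).2]
  choose cx hcxΩ hcx hcxδ using hpx
  choose cy hcyΩ hcy hcyδ using hpy
  have hxside := hmain F hF hquasi hquasi' x hx R hR hxR cx hcxΩ
    (fun k => by rw [hcx k]; linarith [(hhalf k).1]) hcxδ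
  have hyside := hmain F hF hquasi hquasi' y hy R hR hyR (fun k => if k = 0 then cx 0 else cy k)
    (fun k => by split_ifs; exacts [hcxΩ 0, hcyΩ k])
    (fun k => by
      split_ifs with hk
      · have h2 := dist_triangle (cx 0) x y
        rw [hcx 0] at h2
        rw [hk]
        norm_num at h2 ⊢
        linarith
      · rw [hcy k]; linarith [(hhalf k).1])
    (fun k => by
      split_ifs with hk
      · rw [hk]; exact hcxδ 0
      · exact hcyδ k)
  simp only [if_true] at hyside
  set ν := ballUnif (cx 0) (θ / (10 * C ^ 2) * (R / 2)) with hν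
  have : IsProbabilityMeasure ν := isProbabilityMeasure_ballUnif _ (by positivity)
  calc F x y = pairMean F (Measure.dirac x) (Measure.dirac y) := (pairMean_dirac_dirac hF x y).symm
    _ ≤ L * pairMean F (Measure.dirac x) ν + L * pairMean F ν (Measure.dirac y) :=
      pairMean_triangle hF hquasi _ _ _
    _ ≤ L * (M * chainBound Ω ε B (localOsc Ω θ F) x R) +
        L * (M * chainBound Ω ε B (localOsc Ω θ F) y R) := by
      rw [pairMean_comm hF hsymm ν]
      gcongr
    _ = _ := by ring

theorem setLIntegral_le_of_layers {X : Type*} [MeasurableSpace X] (μ : Measure X) {S : Set X}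
    {Φ : X → ℝ≥0∞} (hΦ : Measurable Φ) {T : ℕ → Set X} (hT : ∀ j, MeasurableSet (T j))
    {c : ℕ → ℝ≥0∞} {A τ : ℝ≥0∞} (hS : ∀ x ∈ S, ∃ j, x ∈ T j ∧ Φ x ≤ c j)
    (hc : ∀ j, c j * μ (T j) ≤ A * τ ^ j) : ∫⁻ x in S, Φ x ∂μ ≤ A * (1 - τ)⁻¹ := by
  have hsub : S ⊆ ⋃ j, T j ∩ {x | Φ x ≤ c j} := fun x hx => by
    obtain ⟨j, hj⟩ := hS x hx
    exact mem_iUnion.2 ⟨j, hj⟩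
  calc ∫⁻ x in S, Φ x ∂μ ≤ ∫⁻ x in ⋃ j, T j ∩ {x | Φ x ≤ c j}, Φ x ∂μ := lintegral_mono_set hsub
    _ ≤ ∑' j, ∫⁻ x in T j ∩ {x | Φ x ≤ c j}, Φ x ∂μ := lintegral_iUnion_le _ _
    _ ≤ ∑' j, A * τ ^ j := by
      refine ENNReal.tsum_le_tsum fun j => ?_
      calc ∫⁻ x in T j ∩ {x | Φ x ≤ c j}, Φ x ∂μ ≤ ∫⁻ _ in T j ∩ {x | Φ x ≤ c j}, c j ∂μ :=
            setLIntegral_mono' ((hT j).inter (measurableSet_le hΦ measurable_const))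
              fun x hx => hx.2
        _ = c j * μ (T j ∩ {x | Φ x ≤ c j}) := setLIntegral_const _ _
        _ ≤ c j * μ (T j) := by gcongr; exact inter_subset_left
        _ ≤ _ := hc j
    _ = _ := by rw [ENNReal.tsum_mul_left, ENNReal.tsum_geometric]

theorem inv_one_sub_ofReal_two_rpow_ne_top {κ : ℝ} (hκ : 0 < κ) :
    (1 - ENNReal.ofReal (2 ^ (-κ)))⁻¹ ≠ ⊤ := by
  rw [ENNReal.inv_ne_top]
  have : (2 : ℝ) ^ (-κ) < 1 := Real.rpow_lt_one_of_one_lt_of_neg (by norm_num) (by linarith)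
  have h2 : ENNReal.ofReal (2 ^ (-κ)) < 1 := by
    rw [← ENNReal.ofReal_one]
    exact (ENNReal.ofReal_lt_ofReal_iff one_pos).2 this
  exact (tsub_pos_of_lt h2).ne'

theorem exists_setLIntegral_frontier_ball_le {d : ℕ} {Ω : Set (Rd d)} (hΩ : IsOpen Ω)
    (hfr : (frontier Ω).Nonempty) {q β : ℝ} (hq : q ∈ lowerCodimSet (frontier Ω)) (hβ : β < q)
    (hβ0 : 0 ≤ β) :
    ∃ A : ℝ≥0∞, A ≠ ⊤ ∧ ∀ x ∈ frontier Ω, ∀ R : ℝ, 0 < R →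
      ENNReal.ofReal R < Metric.ediam (frontier Ω) →
      ∫⁻ y in Ω ∩ ball x R, ENNReal.ofReal (distBd Ω y ^ (-β)) ≤
        A * ENNReal.ofReal (R ^ (d - β)) := by
  obtain ⟨hq0, C, hC1, hC⟩ := hq
  have hω : volume (ball (0 : Rd d) 1) ≠ ⊤ := measure_ball_lt_top.ne
  have hinv := inv_one_sub_ofReal_two_rpow_ne_top (sub_pos.2 hβ)
  refine ⟨ENNReal.ofReal (C * 2 ^ β) * volume (ball (0 : Rd d) 1) *
    (1 - ENNReal.ofReal (2 ^ (-(q - β))))⁻¹, by finiteness, fun x hx R hR hRd => ?_⟩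
  have hΦ : Measurable fun y => ENNReal.ofReal (distBd Ω y ^ (-β)) := by fun_prop
  refine (setLIntegral_le_of_layers volume hΦ
    (T := fun j => cthickening (R / 2 ^ j) (frontier Ω) ∩ ball x R)
    (c := fun j => ENNReal.ofReal ((R / 2 ^ (j + 1)) ^ (-β)))
    (A := ENNReal.ofReal (C * 2 ^ β) * volume (ball (0 : Rd d) 1) * ENNReal.ofReal (R ^ (d - β)))
    (τ := ENNReal.ofReal (2 ^ (-(q - β))))
    (fun j => isClosed_cthickening.measurableSet.inter measurableSet_ball) ?_ ?_).trans
    (le_of_eq (by ring))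
  · rintro y ⟨hyΩ, hyx⟩
    have hδ := distBd_pos hΩ hfr hyΩ
    have hδR : distBd Ω y < R := (infDist_le_dist_of_mem hx).trans_lt hyx
    obtain ⟨j, hj1, hj2⟩ := exists_nat_pow_near_of_lt_one (div_pos hδ hR)
      ((div_le_one hR).2 hδR.le) (by norm_num : (0 : ℝ) < 1 / 2) (by norm_num)
    rw [lt_div_iff₀ hR, one_div_pow, one_div_mul_eq_div] at hj1
    rw [div_le_iff₀ hR, one_div_pow, one_div_mul_eq_div] at hj2
    obtain ⟨z, hz, hzd⟩ := isClosed_frontier.exists_infDist_eq_dist hfr y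
    refine ⟨j, ⟨mem_cthickening_of_dist_le y z _ _ hz (hzd ▸ hj2), hyx⟩, ?_⟩
    apply ENNReal.ofReal_le_ofReal
    exact Real.rpow_le_rpow_of_nonpos (by positivity) hj1.le (by linarith)
  · intro j
    have hvol : volume (cthickening (R / 2 ^ j) (frontier Ω) ∩ ball x R) ≤
        ENNReal.ofReal (C * (1 / 2 ^ j) ^ q) * volume (ball x R) := by
      rcases Nat.eq_zero_or_pos j with rfl | hj
      · calc _ ≤ 1 * volume (ball x R) := by rw [one_mul]; exact measure_mono inter_subset_right
          _ ≤ _ := by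
            gcongr
            simpa using hC1
      · have := hC x hx (R / 2 ^ j) R (by positivity)
          (div_lt_self hR (one_lt_pow₀ (by norm_num) (by omega))) hRd
        rwa [div_right_comm, div_self hR.ne'] at this
    grw [hvol, volume_ball_rd x hR]
    apply le_of_eq
    have hreal : (R / 2 ^ (j + 1)) ^ (-β) * (C * (1 / 2 ^ j) ^ q) * R ^ (d : ℝ) =
        (C * 2 ^ β) * R ^ (d - β) * (2 ^ (-(q - β))) ^ j := by
      rw [← Real.rpow_natCast 2 (j + 1), ← Real.rpow_natCast 2 j, ← Real.rpow_natCast _ j,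
        ← Real.rpow_mul (by norm_num), Real.div_rpow hR.le (by positivity),
        ← Real.rpow_mul (by norm_num), one_div, ← Real.rpow_neg (by norm_num),
        ← Real.rpow_mul (by norm_num), div_eq_mul_inv, ← Real.rpow_neg (by norm_num)]
      have e1 : R ^ ((d : ℝ) - β) = R ^ (-β) * R ^ (d : ℝ) := by
        rw [← Real.rpow_add hR]; ring_nf
      have e2 : (2 : ℝ) ^ (-(((j + 1 : ℕ) : ℝ) * -β)) * 2 ^ (-(j : ℝ) * q) =
          2 ^ β * 2 ^ (-(q - β) * j) := by
        rw [← Real.rpow_add (by norm_num), ← Real.rpow_add (by norm_num)]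
        push_cast; ring_nf
      rw [e1]
      linear_combination (R ^ (-β) * C * R ^ (d : ℝ)) * e2
    have hC0 : 0 ≤ C := by linarith
    calc _ = ENNReal.ofReal ((R / 2 ^ (j + 1)) ^ (-β) * (C * (1 / 2 ^ j) ^ q) * R ^ (d : ℝ)) *
          volume (ball (0 : Rd d) 1) := by
          rw [ENNReal.ofReal_mul (p := (R / 2 ^ (j + 1)) ^ (-β) * (C * (1 / 2 ^ j) ^ q))
            (by positivity), ENNReal.ofReal_mul (p := (R / 2 ^ (j + 1)) ^ (-β)) (by positivity)]
          ring
      _ = _ := by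
          rw [hreal, ENNReal.ofReal_mul (p := C * 2 ^ β * R ^ (d - β)) (by positivity),
            ENNReal.ofReal_mul (p := C * 2 ^ β) (by positivity), ENNReal.ofReal_pow (by positivity)]
          ring

theorem exists_pos_ofReal_lt {a : ℝ≥0∞} (ha : 0 < a) : ∃ D : ℝ, 0 < D ∧ ENNReal.ofReal D < a := by
  obtain ⟨D, hD0, hD⟩ := ENNReal.lt_iff_exists_nnreal_btwn.1 ha
  exact ⟨D, by simpa using hD0, by simpa using hD⟩

theorem le_of_mem_lowerCodimSet {d : ℕ} {E : Set (Rd d)} (hE : 0 < Metric.ediam E) {q : ℝ}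
    (hq : q ∈ lowerCodimSet E) : q ≤ d := by
  obtain ⟨hq0, C, hC1, hC⟩ := hq
  obtain ⟨R, hR, hRd⟩ := exists_pos_ofReal_lt hE
  obtain ⟨x, hx⟩ : E.Nonempty := by
    by_contra! h
    simp [h] at hE
  by_contra! hlt
  have hbound : ∀ n : ℕ, ((2 : ℝ) ^ (q - d)) ^ (n + 1) ≤ C := by
    intro n
    have hr : 0 < R / 2 ^ (n + 1) := by positivity
    have hrR : R / 2 ^ (n + 1) < R := div_lt_self hR (one_lt_pow₀ (by norm_num) (by omega))
    have hsub : ball x (R / 2 ^ (n + 1)) ⊆ cthickening (R / 2 ^ (n + 1)) E ∩ ball x R :=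
      fun y hy => ⟨mem_cthickening_of_dist_le y x _ _ hx (mem_ball.1 hy).le,
        ball_subset_ball hrR.le hy⟩
    have h := (measure_mono hsub).trans (hC x hx _ R hr hrR hRd)
    rw [volume_ball_rd x hr, volume_ball_rd x hR, ← mul_assoc,
      ENNReal.mul_le_mul_iff_left (volume_ball_rd_ne_zero _ one_pos) measure_ball_lt_top.ne,
      ← ENNReal.ofReal_mul (by positivity), ENNReal.ofReal_le_ofReal_iff (by positivity),
      div_right_comm, div_self hR.ne', Real.div_rpow hR.le (by positivity), one_div,
      Real.inv_rpow (by positivity), ← Real.rpow_natCast, ← Real.rpow_mul (by norm_num),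
      ← Real.rpow_mul (by norm_num), div_le_iff₀ (by positivity)] at h
    have h2 : 1 ≤ C * (((2 : ℝ) ^ (((n + 1 : ℕ) : ℝ) * q))⁻¹ * 2 ^ (((n + 1 : ℕ) : ℝ) * d)) := by
      refine le_of_mul_le_mul_right ?_ (show 0 < R ^ (d : ℝ) by positivity)
      linarith
    rw [← Real.rpow_natCast, ← Real.rpow_mul (by norm_num)]
    rw [← Real.rpow_neg (by norm_num), ← Real.rpow_add (by norm_num)] at h2
    rw [← div_le_iff₀ (by positivity), one_div, ← Real.rpow_neg (by norm_num)] at h2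
    refine le_of_eq_of_le (congrArg _ ?_) h2
    ring
  obtain ⟨n, hn⟩ := pow_unbounded_of_one_lt C
    (Real.one_lt_rpow (by norm_num : (1 : ℝ) < 2) (sub_pos.2 hlt))
  have h1 := hbound n
  have h2 : ((2 : ℝ) ^ (q - d)) ^ n ≤ (2 ^ (q - d)) ^ (n + 1) :=
    pow_le_pow_right₀ (Real.one_le_rpow (by norm_num) (by linarith)) (by omega)
  linarith

theorem setLIntegral_distBd_rpow_ne_top {d : ℕ} {Ω : Set (Rd d)} (hΩ : IsOpen Ω)
    (hbdd : Bornology.IsBounded Ω) (hfr : (frontier Ω).Nonempty)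
    (hdiam : 0 < Metric.ediam (frontier Ω)) {q β : ℝ} (hq : q ∈ lowerCodimSet (frontier Ω))
    (hβ : β < q) (hβ0 : 0 ≤ β) : ∫⁻ y in Ω, ENNReal.ofReal (distBd Ω y ^ (-β)) ≠ ⊤ := by
  obtain ⟨A, hA, hball⟩ := exists_setLIntegral_frontier_ball_le hΩ hfr hq hβ hβ0
  obtain ⟨D, hD, hDd⟩ := exists_pos_ofReal_lt hdiam
  have hcpt : IsCompact (frontier Ω) :=
    isCompact_of_isClosed_isBounded isClosed_frontier (hbdd.closure.subset frontier_subset_closure)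
  obtain ⟨t, htE, htfin, htcov⟩ := hcpt.finite_cover_balls (half_pos hD)
  have hmeas : Measurable fun y => ENNReal.ofReal (distBd Ω y ^ (-β)) := by fun_prop
  have hcover : Ω ⊆ (Ω ∩ {y | D / 2 ≤ distBd Ω y}) ∪ ⋃ z ∈ t, Ω ∩ ball z D := by
    intro y hy
    by_cases h : D / 2 ≤ distBd Ω y
    · exact Or.inl ⟨hy, h⟩
    obtain ⟨w, hw, hwd⟩ := isClosed_frontier.exists_infDist_eq_dist hfr y
    obtain ⟨z, hz, hwz⟩ := mem_iUnion₂.1 (htcov hw)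
    refine Or.inr (mem_iUnion₂.2 ⟨z, hz, hy, ?_⟩)
    have h1 : dist y w < D / 2 := by rw [← hwd]; exact not_le.1 h
    have := dist_triangle y w z
    rw [mem_ball] at hwz ⊢
    linarith
  have hfar : ∫⁻ y in Ω ∩ {y | D / 2 ≤ distBd Ω y}, ENNReal.ofReal (distBd Ω y ^ (-β)) ≠ ⊤ := by
    have hvol : volume Ω ≠ ⊤ := hbdd.measure_lt_top.ne
    refine ne_top_of_le_ne_top
      (ENNReal.mul_ne_top (ENNReal.ofReal_ne_top (r := (D / 2) ^ (-β))) hvol) ?_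
    calc _ ≤ ∫⁻ y in Ω ∩ {y | D / 2 ≤ distBd Ω y}, ENNReal.ofReal ((D / 2) ^ (-β)) := by
          refine setLIntegral_mono measurable_const fun y hy => ?_
          exact ENNReal.ofReal_le_ofReal
            (Real.rpow_le_rpow_of_nonpos (by positivity) hy.2 (by linarith))
      _ = _ := setLIntegral_const _ _
      _ ≤ _ := by gcongr; exact inter_subset_left
  refine ne_top_of_le_ne_top ?_ ((lintegral_mono_set hcover).trans (lintegral_union_le _ _ _))
  refine ENNReal.add_ne_top.2 ⟨hfar, ?_⟩
  have := htfin.to_subtype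
  have := Fintype.ofFinite t
  rw [biUnion_eq_iUnion]
  refine ne_top_of_le_ne_top ?_ (lintegral_iUnion_le _ _)
  rw [tsum_fintype]
  refine ENNReal.sum_ne_top.2 fun z _ => ?_
  exact ne_top_of_le_ne_top (by finiteness) (hball z (htE z.2) D hD hDd)

theorem exists_setLIntegral_ball_le {d : ℕ} {Ω : Set (Rd d)} (hΩ : IsOpen Ω)
    (hbdd : Bornology.IsBounded Ω) (hfr : (frontier Ω).Nonempty)
    (hdiam : 0 < Metric.ediam (frontier Ω)) {q β : ℝ} (hq : q ∈ lowerCodimSet (frontier Ω))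
    (hβ : β < q) (hβ0 : 0 ≤ β) {c : ℝ} (hc : 0 < c) :
    ∃ A : ℝ≥0∞, A ≠ ⊤ ∧ ∀ (x : Rd d) (r : ℝ), 0 < r → distBd Ω x ≤ c * r →
      ∫⁻ y in Ω ∩ ball x r, ENNReal.ofReal (distBd Ω y ^ (-β)) ≤
        A * ENNReal.ofReal (r ^ (d - β)) := by
  obtain ⟨A, hA, hball⟩ := exists_setLIntegral_frontier_ball_le hΩ hfr hq hβ hβ0
  have htot := setLIntegral_distBd_rpow_ne_top hΩ hbdd hfr hdiam hq hβ hβ0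
  have hβd : 0 < d - β := by linarith [le_of_mem_lowerCodimSet hdiam hq]
  obtain ⟨D, hD, hDd⟩ := exists_pos_ofReal_lt hdiam
  set I := ∫⁻ y in Ω, ENNReal.ofReal (distBd Ω y ^ (-β)) with hI
  refine ⟨A * ENNReal.ofReal ((c + 1) ^ (d - β)) + I * ENNReal.ofReal ((D / (c + 1)) ^ (-(d - β))),
    by finiteness, fun x r hr hx => ?_⟩
  rw [add_mul]
  rcases le_or_gt ((c + 1) * r) D with hrD | hrD
  · refine le_trans ?_ le_self_add
    obtain ⟨w, hw, hwd⟩ := isClosed_frontier.exists_infDist_eq_dist hfr x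
    have hxw : dist x w ≤ c * r := hwd ▸ hx
    have hsub : ball x r ⊆ ball w ((c + 1) * r) := ball_subset_ball' (by linarith)
    calc _ ≤ ∫⁻ y in Ω ∩ ball w ((c + 1) * r), ENNReal.ofReal (distBd Ω y ^ (-β)) :=
          lintegral_mono_set (inter_subset_inter_right _ hsub)
      _ ≤ A * ENNReal.ofReal (((c + 1) * r) ^ (d - β)) :=
          hball w hw _ (by positivity) ((ENNReal.ofReal_le_ofReal hrD).trans_lt hDd)
      _ = _ := by
          rw [Real.mul_rpow (by positivity) hr.le, ENNReal.ofReal_mul (by positivity), mul_assoc]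
  · refine le_trans ?_ le_add_self
    calc _ ≤ I := lintegral_mono_set inter_subset_left
      _ = I * 1 := (mul_one _).symm
      _ ≤ I * (ENNReal.ofReal ((D / (c + 1)) ^ (-(d - β))) * ENNReal.ofReal (r ^ (d - β))) := by
        gcongr
        rw [← ENNReal.ofReal_mul (by positivity), ← ENNReal.ofReal_one]
        apply ENNReal.ofReal_le_ofReal
        rw [Real.rpow_neg (by positivity), ← div_eq_inv_mul, one_le_div (by positivity)]
        apply Real.rpow_le_rpow (by positivity) _ hβd.le
        rw [div_le_iff₀ (by positivity)]
        linarith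
      _ = _ := (mul_assoc _ _ _).symm

theorem exists_setLIntegral_compl_ball_le {d : ℕ} {Ω : Set (Rd d)} (hΩ : IsOpen Ω)
    (hbdd : Bornology.IsBounded Ω) (hfr : (frontier Ω).Nonempty)
    (hdiam : 0 < Metric.ediam (frontier Ω)) {q β : ℝ} (hq : q ∈ lowerCodimSet (frontier Ω))
    (hβ : β < q) (hβ0 : 0 ≤ β) {c κ : ℝ} (hc : 0 < c) (hκ : 0 < κ) :
    ∃ A : ℝ≥0∞, A ≠ ⊤ ∧ ∀ (x : Rd d) (r : ℝ), 0 < r → distBd Ω x ≤ c * r →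
      ∫⁻ y in Ω ∩ {y | r ≤ dist x y},
          ENNReal.ofReal (dist x y ^ (-(d + κ))) * ENNReal.ofReal (distBd Ω y ^ (-β)) ≤
        A * ENNReal.ofReal (r ^ (-(κ + β))) := by
  obtain ⟨A, hA, hball⟩ := exists_setLIntegral_ball_le hΩ hbdd hfr hdiam hq hβ hβ0 hc
  have hκβ : 0 < κ + β := by linarith
  have hinv := inv_one_sub_ofReal_two_rpow_ne_top hκβ
  refine ⟨A * ENNReal.ofReal (2 ^ (d - β)) * (1 - ENNReal.ofReal (2 ^ (-(κ + β))))⁻¹,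
    by finiteness, fun x r hr hx => ?_⟩
  have hw : Measurable fun y => ENNReal.ofReal (distBd Ω y ^ (-β)) := by fun_prop
  have hk : Measurable fun y => ENNReal.ofReal (dist x y ^ (-(d + κ))) := by fun_prop
  have hS : MeasurableSet {y | r ≤ dist x y} := measurableSet_le (by fun_prop) (by fun_prop)
  set μ := (volume.restrict Ω).withDensity fun y => ENNReal.ofReal (distBd Ω y ^ (-β)) with hμ
  have hlhs : ∫⁻ y in Ω ∩ {y | r ≤ dist x y},
      ENNReal.ofReal (dist x y ^ (-(d + κ))) * ENNReal.ofReal (distBd Ω y ^ (-β)) =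
      ∫⁻ y in {y | r ≤ dist x y}, ENNReal.ofReal (dist x y ^ (-(d + κ))) ∂μ := by
    rw [hμ, setLIntegral_withDensity_eq_setLIntegral_mul _ hw hk hS,
      Measure.restrict_restrict hS, inter_comm]
    simp only [Pi.mul_apply, mul_comm]
  rw [hlhs]
  refine (setLIntegral_le_of_layers μ hk (T := fun j => ball x (2 ^ (j + 1) * r))
    (c := fun j => ENNReal.ofReal ((2 ^ j * r) ^ (-(d + κ))))
    (A := A * ENNReal.ofReal (2 ^ (d - β)) * ENNReal.ofReal (r ^ (-(κ + β))))
    (τ := ENNReal.ofReal (2 ^ (-(κ + β)))) (fun j => measurableSet_ball) ?_ ?_).trans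
    (le_of_eq (by ring))
  · intro y hy
    obtain ⟨j, hj1, hj2⟩ := exists_nat_pow_near ((one_le_div hr).2 hy) (one_lt_two (α := ℝ))
    rw [le_div_iff₀ hr] at hj1
    rw [div_lt_iff₀ hr] at hj2
    refine ⟨j, mem_ball'.2 hj2, ENNReal.ofReal_le_ofReal ?_⟩
    exact Real.rpow_le_rpow_of_nonpos (by positivity) hj1 (by linarith [d.cast_nonneg (α := ℝ)])
  · intro j
    have h1 : μ (ball x (2 ^ (j + 1) * r)) ≤
        A * ENNReal.ofReal ((2 ^ (j + 1) * r) ^ (d - β)) := by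
      rw [hμ, withDensity_apply _ measurableSet_ball, Measure.restrict_restrict measurableSet_ball,
        inter_comm]
      refine hball x _ (by positivity) (hx.trans ?_)
      gcongr
      exact le_mul_of_one_le_left hr.le (one_le_pow₀ (by norm_num))
    have hreal : (2 ^ j * r) ^ (-(d + κ)) * (2 ^ (j + 1) * r) ^ (d - β) =
        2 ^ (d - β) * r ^ (-(κ + β)) * (2 ^ (-(κ + β))) ^ j := by
      rw [← Real.rpow_natCast 2 (j + 1), ← Real.rpow_natCast 2 j, ← Real.rpow_natCast _ j,
        ← Real.rpow_mul (by norm_num), Real.mul_rpow (by positivity) hr.le,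
        Real.mul_rpow (by positivity) hr.le,
        ← Real.rpow_mul (by norm_num), ← Real.rpow_mul (by norm_num)]
      have e1 : r ^ (-(κ + β)) = r ^ (-((d : ℝ) + κ)) * r ^ (d - β) := by
        rw [← Real.rpow_add hr]; ring_nf
      have e2 : (2 : ℝ) ^ ((j : ℝ) * -(d + κ)) * 2 ^ (((j + 1 : ℕ) : ℝ) * (d - β)) =
          2 ^ (d - β) * 2 ^ (-(κ + β) * j) := by
        rw [← Real.rpow_add (by norm_num), ← Real.rpow_add (by norm_num)]
        push_cast; ring_nf
      rw [e1]
      linear_combination (r ^ (-((d : ℝ) + κ)) * r ^ (d - β)) * e2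
    calc _ ≤ ENNReal.ofReal ((2 ^ j * r) ^ (-(d + κ))) *
          (A * ENNReal.ofReal ((2 ^ (j + 1) * r) ^ (d - β))) := by gcongr
      _ = A * ENNReal.ofReal ((2 ^ j * r) ^ (-(d + κ)) * (2 ^ (j + 1) * r) ^ (d - β)) := by
        rw [ENNReal.ofReal_mul (by positivity)]; ring
      _ = _ := by
        rw [hreal, ENNReal.ofReal_mul (p := 2 ^ (d - β) * r ^ (-(κ + β))) (by positivity),
          ENNReal.ofReal_mul (p := 2 ^ (d - β)) (by positivity),
          ENNReal.ofReal_pow (by positivity)]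
        ring

theorem lintegral_lintegral_lintegral_rotate {X : Type*} [MeasurableSpace X] {ν : Measure X}
    [SFinite ν] {H : X → X → X → ℝ≥0∞}
    (hH : Measurable fun q : X × X × X => H q.1 q.2.1 q.2.2) :
    ∫⁻ x, ∫⁻ y, ∫⁻ z, H x y z ∂ν ∂ν ∂ν = ∫⁻ z, ∫⁻ x, ∫⁻ y, H x y z ∂ν ∂ν ∂ν := by
  have h1 : ∀ x, ∫⁻ y, ∫⁻ z, H x y z ∂ν ∂ν = ∫⁻ z, ∫⁻ y, H x y z ∂ν ∂ν := fun x =>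
    lintegral_lintegral_swap (hH.comp measurable_prodMk_left).aemeasurable
  simp only [h1]
  refine lintegral_lintegral_swap (Measurable.aemeasurable ?_)
  have h2 : Measurable fun q : (X × X) × X => H q.1.1 q.2 q.1.2 :=
    hH.comp (f := fun q : (X × X) × X => (q.1.1, q.2, q.1.2)) (by fun_prop)
  exact h2.lintegral_prod_right'

theorem exists_lintegral_chain_le {d : ℕ} {Ω : Set (Rd d)} (hΩ : IsOpen Ω)
    (hbdd : Bornology.IsBounded Ω) (hfr : (frontier Ω).Nonempty)
    (hdiam : 0 < Metric.ediam (frontier Ω)) {q α β : ℝ} (hq : q ∈ lowerCodimSet (frontier Ω))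
    (hα : α < q) (hα0 : 0 ≤ α) (hβ : β < q) (hβ0 : 0 ≤ β) {B κ ε : ℝ} (hB : 1 ≤ B)
    (hκ : 0 < κ) :
    ∃ A : ℝ≥0∞, A ≠ ⊤ ∧ ∀ O : Rd d → ℝ≥0∞, Measurable O →
      ∫⁻ x in Ω, ∫⁻ y in Ω, ENNReal.ofReal (distBd Ω x ^ (-α)) *
          (ENNReal.ofReal (dist x y ^ (-(d + κ))) * ENNReal.ofReal (distBd Ω y ^ (-β))) *
          ∫⁻ z in {z | z ∈ Ω ∧ dist z x ≤ B * distBd Ω z ∧ distBd Ω z ≤ B * dist x y},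
            ENNReal.ofReal (distBd Ω z ^ (-(2 * d + ε))) * O z ≤
        A * ∫⁻ z in Ω, ENNReal.ofReal (distBd Ω z ^ (-(d + κ + ε + α + β))) * O z := by
  have hB0 : 0 < B := by linarith
  obtain ⟨A₁, hA₁, h₁⟩ := exists_setLIntegral_compl_ball_le hΩ hbdd hfr hdiam hq hβ hβ0
    (c := (1 + B) * B) (κ := κ) (by positivity) hκ
  obtain ⟨A₂, hA₂, h₂⟩ := exists_setLIntegral_ball_le hΩ hbdd hfr hdiam hq hα hα0
    (c := 1 / (2 * B)) (by positivity)
  refine ⟨A₁ * A₂ * ENNReal.ofReal (B⁻¹ ^ (-(κ + β)) * (2 * B) ^ (d - α)), by finiteness,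
    fun O hO => ?_⟩
  classical
  set K : Rd d → Rd d → ℝ≥0∞ := fun x y =>
    ENNReal.ofReal (dist x y ^ (-(d + κ))) * ENNReal.ofReal (distBd Ω y ^ (-β)) with hK
  set g : Rd d → ℝ≥0∞ := fun z => ENNReal.ofReal (distBd Ω z ^ (-(2 * d + ε))) * O z with hg
  set T : Rd d → Rd d → Rd d → ℝ≥0∞ := fun x y z =>
    if dist z x ≤ B * distBd Ω z ∧ distBd Ω z ≤ B * dist x y then 1 else 0 with hT
  set H : Rd d → Rd d → Rd d → ℝ≥0∞ := fun x y z =>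
    ENNReal.ofReal (distBd Ω x ^ (-α)) * K x y * (T x y z * g z) with hH
  have hgm : Measurable g := by fun_prop
  have hTm : Measurable fun q : Rd d × Rd d × Rd d => T q.1 q.2.1 q.2.2 := by
    refine Measurable.ite ?_ measurable_const measurable_const
    rw [ofPred_and]
    refine (measurableSet_le ?_ ?_).inter (measurableSet_le ?_ ?_) <;> fun_prop
  have hHm : Measurable fun q : Rd d × Rd d × Rd d => H q.1 q.2.1 q.2.2 := by
    simp only [hH, hK]
    fun_prop
  have hstep : ∀ x y, ENNReal.ofReal (distBd Ω x ^ (-α)) * K x y *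
      ∫⁻ z in {z | z ∈ Ω ∧ dist z x ≤ B * distBd Ω z ∧ distBd Ω z ≤ B * dist x y}, g z =
      ∫⁻ z in Ω, H x y z := by
    intro x y
    have hS : MeasurableSet {z | dist z x ≤ B * distBd Ω z ∧ distBd Ω z ≤ B * dist x y} := by
      rw [ofPred_and]
      refine (measurableSet_le ?_ ?_).inter (measurableSet_le ?_ ?_) <;> fun_prop
    have hTz : ∀ z, T x y z * g z =
        {z | dist z x ≤ B * distBd Ω z ∧ distBd Ω z ≤ B * dist x y}.indicator g z := by
      intro z
      simp only [hT, indicator, mem_ofPred_eq]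
      split_ifs <;> simp
    simp only [hH]
    rw [lintegral_const_mul _ (by simp only [hTz]; exact hgm.indicator hS)]
    simp only [hTz]
    rw [setLIntegral_indicator hS, inter_comm]
    rfl
  rw [lintegral_congr fun x => lintegral_congr fun y => hstep x y]
  rw [lintegral_lintegral_lintegral_rotate hHm, ← lintegral_const_mul _ (by fun_prop)]
  refine setLIntegral_mono' hΩ.measurableSet fun z hz => ?_
  have hδ := distBd_pos hΩ hfr hz
  have hinner : ∀ x, ∫⁻ y in Ω, H x y z ≤
      (ball z (2 * B * distBd Ω z)).indicator (fun x => ENNReal.ofReal (distBd Ω x ^ (-α)) *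
        (g z * (A₁ * ENNReal.ofReal ((distBd Ω z / B) ^ (-(κ + β)))))) x := by
    intro x
    by_cases hxz : dist z x ≤ B * distBd Ω z
    · have hmem : x ∈ ball z (2 * B * distBd Ω z) := by
        have : 0 < B * distBd Ω z := by positivity
        rw [mem_ball']
        linarith
      have hS : MeasurableSet {y | distBd Ω z / B ≤ dist x y} :=
        measurableSet_le (by fun_prop) (by fun_prop)
      have hHy : ∀ y, H x y z = ENNReal.ofReal (distBd Ω x ^ (-α)) * (g z *
          {y | distBd Ω z / B ≤ dist x y}.indicator (K x) y) := by
        intro y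
        simp only [hH, hT, indicator, mem_ofPred_eq, div_le_iff₀' hB0, hxz, true_and]
        split_ifs
        · ring
        · simp
      have hKm : Measurable (K x) := by fun_prop
      simp only [hHy]
      rw [indicator_of_mem hmem, lintegral_const_mul _ ((hKm.indicator hS).const_mul _),
        lintegral_const_mul _ (hKm.indicator hS), setLIntegral_indicator hS, inter_comm]
      gcongr
      refine h₁ x _ (by positivity) ?_
      calc distBd Ω x ≤ distBd Ω z + dist x z := distBd_le_add Ω x z
        _ ≤ distBd Ω z + B * distBd Ω z := by rw [dist_comm]; gcongr
        _ = _ := by field_simp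
    · have hH0 : ∀ y, H x y z = 0 := fun y => by simp [hH, hT, hxz]
      simp [hH0]
  calc ∫⁻ x in Ω, ∫⁻ y in Ω, H x y z
      ≤ ∫⁻ x in Ω, (ball z (2 * B * distBd Ω z)).indicator
          (fun x => ENNReal.ofReal (distBd Ω x ^ (-α)) *
            (g z * (A₁ * ENNReal.ofReal ((distBd Ω z / B) ^ (-(κ + β)))))) x :=
        lintegral_mono hinner
    _ = (∫⁻ x in Ω ∩ ball z (2 * B * distBd Ω z), ENNReal.ofReal (distBd Ω x ^ (-α))) *
          (g z * (A₁ * ENNReal.ofReal ((distBd Ω z / B) ^ (-(κ + β))))) := by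
        rw [setLIntegral_indicator measurableSet_ball, inter_comm,
          lintegral_mul_const _ (by fun_prop)]
    _ ≤ A₂ * ENNReal.ofReal ((2 * B * distBd Ω z) ^ (d - α)) *
          (g z * (A₁ * ENNReal.ofReal ((distBd Ω z / B) ^ (-(κ + β))))) := by
        gcongr
        refine h₂ z _ (by positivity) (le_of_eq ?_)
        field_simp
    _ = A₁ * A₂ * (ENNReal.ofReal ((distBd Ω z / B) ^ (-(κ + β)) *
          (2 * B * distBd Ω z) ^ (d - α) * distBd Ω z ^ (-(2 * d + ε))) * O z) := by
        rw [ENNReal.ofReal_mul (by positivity), ENNReal.ofReal_mul (by positivity), hg]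
        ring
    _ = _ := by
        have hreal : (distBd Ω z / B) ^ (-(κ + β)) * (2 * B * distBd Ω z) ^ (d - α) *
            distBd Ω z ^ (-(2 * d + ε)) = B⁻¹ ^ (-(κ + β)) * (2 * B) ^ (d - α) *
            distBd Ω z ^ (-(d + κ + ε + α + β)) := by
          rw [div_eq_mul_inv, Real.mul_rpow hδ.le (by positivity),
            Real.mul_rpow (by positivity) hδ.le]
          have e : distBd Ω z ^ (-(d + κ + ε + α + β)) = distBd Ω z ^ (-(κ + β)) *
              distBd Ω z ^ (d - α) * distBd Ω z ^ (-(2 * d + ε)) := by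
            rw [← Real.rpow_add hδ, ← Real.rpow_add hδ]
            ring_nf
          rw [e]
          ring
        rw [hreal, ENNReal.ofReal_mul (p := B⁻¹ ^ (-(κ + β)) * (2 * B) ^ (d - α)) (by positivity)]
        ring

theorem exists_lintegral_chainBound_le {d : ℕ} {Ω : Set (Rd d)} (hΩ : IsOpen Ω)
    (hbdd : Bornology.IsBounded Ω) (hfr : (frontier Ω).Nonempty)
    (hdiam : 0 < Metric.ediam (frontier Ω)) {q α β : ℝ} (hq : q ∈ lowerCodimSet (frontier Ω))
    (hα : α < q) (hα0 : 0 ≤ α) (hβ : β < q) (hβ0 : 0 ≤ β) {B κ ε τ : ℝ} (hB : 1 ≤ B)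
    (hκ : 0 < κ) (hτ : 0 < τ) :
    ∃ A : ℝ≥0∞, A ≠ ⊤ ∧ ∀ O : Rd d → ℝ≥0∞, Measurable O →
      ∫⁻ x in Ω, ∫⁻ y in Ω ∩ {y | τ * distBd Ω x ≤ dist x y},
          ENNReal.ofReal (dist x y ^ (-(d + κ + ε))) * ENNReal.ofReal (distBd Ω y ^ (-β)) *
          ENNReal.ofReal (distBd Ω x ^ (-α)) * chainBound Ω ε B O x (dist x y) ≤
        A * ∫⁻ z in Ω, ENNReal.ofReal (distBd Ω z ^ (-(d + κ + ε + α + β))) * O z := by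
  obtain ⟨A₁, hA₁, h₁⟩ := exists_setLIntegral_compl_ball_le hΩ hbdd hfr hdiam hq hβ hβ0
    (c := 1 / τ) (κ := κ) (by positivity) hκ
  obtain ⟨A₂, hA₂, h₂⟩ := exists_lintegral_chain_le hΩ hbdd hfr hdiam hq hα hα0 hβ hβ0 hB hκ (ε := ε)
  refine ⟨A₁ * ENNReal.ofReal (τ ^ (-(κ + β))) + A₂, by finiteness, fun O hO => ?_⟩
  rw [add_mul]
  refine le_trans ?_ (add_le_add_right (h₂ O hO) _)
  set K : Rd d → Rd d → ℝ≥0∞ := fun x y =>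
    ENNReal.ofReal (dist x y ^ (-(d + κ))) * ENNReal.ofReal (distBd Ω y ^ (-β)) with hK
  have hKm : ∀ x, Measurable (K x) := fun x => by simp only [hK]; fun_prop
  rw [← lintegral_const_mul _ (by fun_prop), ← lintegral_add_left (by fun_prop)]
  refine setLIntegral_mono' hΩ.measurableSet fun x hx => ?_
  have hδ := distBd_pos hΩ hfr hx
  set J : Rd d → ℝ≥0∞ := fun y =>
    ∫⁻ z in {z | z ∈ Ω ∧ dist z x ≤ B * distBd Ω z ∧ distBd Ω z ≤ B * dist x y},
      ENNReal.ofReal (distBd Ω z ^ (-(2 * d + ε))) * O z with hJ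
  have hS : MeasurableSet {y | τ * distBd Ω x ≤ dist x y} :=
    measurableSet_le (by fun_prop) (by fun_prop)
  calc _ = ∫⁻ y in Ω ∩ {y | τ * distBd Ω x ≤ dist x y},
        (ENNReal.ofReal (distBd Ω x ^ (-α)) * (ENNReal.ofReal (distBd Ω x ^ (-(d + ε))) * O x) *
          K x y + ENNReal.ofReal (distBd Ω x ^ (-α)) * K x y * J y) := by
        refine setLIntegral_congr_fun (hΩ.measurableSet.inter hS) fun y hy => ?_
        have hr : 0 < dist x y := lt_of_lt_of_le (by positivity) hy.2
        have e : ENNReal.ofReal (dist x y ^ (-(d + κ))) =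
            ENNReal.ofReal (dist x y ^ (-(d + κ + ε))) * ENNReal.ofReal (dist x y ^ ε) := by
          rw [← ENNReal.ofReal_mul (by positivity), ← Real.rpow_add hr]
          ring_nf
        simp only [hK, e, chainBound]
        ring
    _ = (∫⁻ y in Ω ∩ {y | τ * distBd Ω x ≤ dist x y},
          ENNReal.ofReal (distBd Ω x ^ (-α)) * (ENNReal.ofReal (distBd Ω x ^ (-(d + ε))) * O x) *
          K x y) + ∫⁻ y in Ω ∩ {y | τ * distBd Ω x ≤ dist x y},
          ENNReal.ofReal (distBd Ω x ^ (-α)) * K x y * J y :=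
        lintegral_add_left ((hKm x).const_mul _) _
    _ ≤ _ := by
        gcongr
        · rw [lintegral_const_mul _ (hKm x)]
          grw [h₁ x (τ * distBd Ω x) (by positivity) (by field_simp; rfl)]
          apply le_of_eq
          have hreal : distBd Ω x ^ (-α) * distBd Ω x ^ (-(d + ε)) *
              (τ * distBd Ω x) ^ (-(κ + β)) =
              τ ^ (-(κ + β)) * distBd Ω x ^ (-(d + κ + ε + α + β)) := by
            rw [Real.mul_rpow hτ.le hδ.le]
            have e : distBd Ω x ^ (-(d + κ + ε + α + β)) = distBd Ω x ^ (-α) *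
                distBd Ω x ^ (-(d + ε)) * distBd Ω x ^ (-(κ + β)) := by
              rw [← Real.rpow_add hδ, ← Real.rpow_add hδ]
              ring_nf
            rw [e]
            ring
          calc _ = A₁ * (ENNReal.ofReal (distBd Ω x ^ (-α) * distBd Ω x ^ (-(d + ε)) *
                (τ * distBd Ω x) ^ (-(κ + β))) * O x) := by
                rw [ENNReal.ofReal_mul (by positivity), ENNReal.ofReal_mul (by positivity)]
                ring
            _ = _ := by
                rw [hreal, ENNReal.ofReal_mul (by positivity)]
                ring
        · exact inter_subset_left

theorem exists_add_smul_mem_frontier {E : Type*} [NormedAddCommGroup E] [NormedSpace ℝ E]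
    {Ω : Set E} (hΩ : IsOpen Ω) (hbdd : Bornology.IsBounded Ω) {x v : E} (hx : x ∈ Ω)
    (hv : v ≠ 0) : ∃ t : ℝ, 0 < t ∧ x + t • v ∈ frontier Ω := by
  have hcont : Continuous fun t : ℝ => x + t • v := by fun_prop
  have hray : IsPreconnected ((fun t : ℝ => x + t • v) '' Ici 0) :=
    isPreconnected_Ici.image _ hcont.continuousOn
  have hx0 : x ∈ (fun t : ℝ => x + t • v) '' Ici 0 := ⟨0, self_mem_Ici, by simp⟩
  by_contra! h
  have hsub : (fun t : ℝ => x + t • v) '' Ici 0 ⊆ Ω := by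
    refine hray.subset_of_closure_inter_subset hΩ ⟨x, hx0, hx⟩ ?_
    rintro _ ⟨hcl, t, ht, rfl⟩
    by_contra hnot
    rcases (mem_Ici.1 ht).eq_or_lt with rfl | ht0
    · simp [hx] at hnot
    · exact h t ht0 (by rw [hΩ.frontier_eq]; exact ⟨hcl, hnot⟩)
  obtain ⟨r, hr⟩ := hbdd.subset_closedBall x
  have hv0 : 0 < ‖v‖ := norm_pos_iff.2 hv
  have hmem := hr (hsub ⟨(|r| + 1) / ‖v‖, mem_Ici.2 (by positivity), rfl⟩)
  simp only [mem_closedBall, dist_self_add_left, norm_smul, norm_div, norm_norm] at hmem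
  rw [div_mul_cancel₀ _ hv0.ne', Real.norm_of_nonneg (by positivity)] at hmem
  linarith [le_abs_self r]

theorem ediam_frontier_pos {E : Type*} [NormedAddCommGroup E] [NormedSpace ℝ E] [Nontrivial E]
    {Ω : Set E} (hΩ : IsOpen Ω) (hbdd : Bornology.IsBounded Ω) (hne : Ω.Nonempty) :
    0 < Metric.ediam (frontier Ω) := by
  obtain ⟨x, hx⟩ := hne
  obtain ⟨v, hv⟩ := exists_ne (0 : E)
  obtain ⟨t, ht, htf⟩ := exists_add_smul_mem_frontier hΩ hbdd hx hv
  obtain ⟨r, hr, hrf⟩ := exists_add_smul_mem_frontier hΩ hbdd hx (neg_ne_zero.2 hv)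
  refine Metric.ediam_pos_iff.2 ⟨_, htf, _, hrf, fun h => ?_⟩
  rw [add_right_inj, smul_neg, ← add_eq_zero_iff_eq_neg, ← add_smul] at h
  exact (add_pos ht hr).ne' ((smul_eq_zero.1 h).resolve_right hv)

theorem exists_mem_lowerCodimSet_gt {d : ℕ} {E : Set (Rd d)} {a : ℝ} (ha0 : 0 ≤ a)
    (ha : a < lowerCodimA E) : ∃ q ∈ lowerCodimSet E, a < q := by
  refine exists_lt_of_lt_csSup ?_ ha
  by_contra! h
  rw [lowerCodimA, h, Real.sSup_empty] at ha
  linarith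

theorem dim_ne_zero_of_lowerCodimA_pos {d : ℕ} {E : Set (Rd d)} (h : 0 < lowerCodimA E) :
    d ≠ 0 := by
  rintro rfl
  have hE : Metric.ediam E = 0 := Metric.ediam_eq_zero_iff.2 E.subsingleton_of_subsingleton
  have hset : lowerCodimSet E = Ici 0 := by
    ext q
    refine ⟨fun hq => hq.1, fun hq => ⟨hq, 1, le_rfl, fun x _ r R _ _ hR => ?_⟩⟩
    exact absurd (hR.trans_eq hE) not_lt_zero
  rw [lowerCodimA, hset, Real.sSup_of_not_bddAbove (not_bddAbove_Ici _)] at h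
  exact lt_irrefl _ h

theorem measurable_chainBound {d : ℕ} {Ω : Set (Rd d)} (hΩ : IsOpen Ω) (ε B : ℝ)
    {O : Rd d → ℝ≥0∞} (hO : Measurable O) :
    Measurable fun q : Rd d × ℝ => chainBound Ω ε B O q.1 q.2 := by
  set S : Set ((Rd d × ℝ) × Rd d) :=
    {w | w.2 ∈ Ω ∧ dist w.2 w.1.1 ≤ B * distBd Ω w.2 ∧ distBd Ω w.2 ≤ B * w.1.2} with hSdef
  have hS : MeasurableSet S := by
    rw [hSdef, ofPred_and, ofPred_and]
    refine (hΩ.measurableSet.preimage measurable_snd).inter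
      ((measurableSet_le ?_ ?_).inter (measurableSet_le ?_ ?_)) <;> fun_prop
  have hint : Measurable fun q : Rd d × ℝ =>
      ∫⁻ z in {z | z ∈ Ω ∧ dist z q.1 ≤ B * distBd Ω z ∧ distBd Ω z ≤ B * q.2},
        ENNReal.ofReal (distBd Ω z ^ (-(2 * d + ε))) * O z := by
    have hg : Measurable fun w : (Rd d × ℝ) × Rd d =>
        ENNReal.ofReal (distBd Ω w.2 ^ (-(2 * d + ε))) * O w.2 := by fun_prop
    convert (hg.indicator hS).lintegral_prod_right' (ν := volume) using 2 with q
    exact (lintegral_indicator (hS.preimage (measurable_prodMk_left (x := q))) _).symm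
  unfold chainBound
  fun_prop

/-- The integrand which dominates the far part of the Gagliardo double integral. -/
noncomputable def chainKernel {d : ℕ} (Ω : Set (Rd d)) (α β σ ε B τ : ℝ) (O : Rd d → ℝ≥0∞)
    (x y : Rd d) : ℝ≥0∞ :=
  {q : Rd d × Rd d | τ * distBd Ω q.1 ≤ dist q.1 q.2}.indicator (fun q =>
    ENNReal.ofReal (dist q.1 q.2 ^ (-(d + σ))) * ENNReal.ofReal (distBd Ω q.2 ^ (-β)) *
      ENNReal.ofReal (distBd Ω q.1 ^ (-α)) * chainBound Ω ε B O q.1 (dist q.1 q.2)) (x, y)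

theorem measurable_chainKernel {d : ℕ} {Ω : Set (Rd d)} (hΩ : IsOpen Ω) (α β σ ε B τ : ℝ)
    {O : Rd d → ℝ≥0∞} (hO : Measurable O) :
    Measurable (Function.uncurry (chainKernel Ω α β σ ε B τ O)) := by
  refine Measurable.indicator ?_ (measurableSet_le (by fun_prop) (by fun_prop))
  have := (measurable_chainBound hΩ ε B hO).comp
    (f := fun q : Rd d × Rd d => (q.1, dist q.1 q.2)) (by fun_prop)
  exact Measurable.mul (by fun_prop) this

theorem exists_lintegral_chainKernel_le {d : ℕ} {Ω : Set (Rd d)} (hΩ : IsOpen Ω)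
    (hbdd : Bornology.IsBounded Ω) (hfr : (frontier Ω).Nonempty)
    (hdiam : 0 < Metric.ediam (frontier Ω)) {q α β : ℝ} (hq : q ∈ lowerCodimSet (frontier Ω))
    (hα : α < q) (hα0 : 0 ≤ α) (hβ : β < q) (hβ0 : 0 ≤ β) {B σ ε τ : ℝ} (hB : 1 ≤ B)
    (hσ : ε < σ) (hτ : 0 < τ) :
    ∃ A : ℝ≥0∞, A ≠ ⊤ ∧ ∀ O : Rd d → ℝ≥0∞, Measurable O →
      ∫⁻ x in Ω, ∫⁻ y in Ω, chainKernel Ω α β σ ε B τ O x y ≤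
        A * ∫⁻ z in Ω, ENNReal.ofReal (distBd Ω z ^ (-(d + σ + α + β))) * O z := by
  obtain ⟨A, hA, h⟩ := exists_lintegral_chainBound_le hΩ hbdd hfr hdiam hq hα hα0 hβ hβ0 hB
    (sub_pos.2 hσ) hτ (ε := ε)
  refine ⟨A, hA, fun O hO => ?_⟩
  have := h O hO
  rw [show (d : ℝ) + (σ - ε) + ε = d + σ by ring] at this
  refine le_of_eq_of_le (lintegral_congr fun x => ?_) this
  have hS : MeasurableSet {y | τ * distBd Ω x ≤ dist x y} :=
    measurableSet_le (by fun_prop) (by fun_prop)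
  rw [inter_comm, ← setLIntegral_indicator hS]
  rfl

theorem lintegral_localOsc_le {d : ℕ} {Ω : Set (Rd d)} (hΩ : IsOpen Ω)
    (hfr : (frontier Ω).Nonempty) {θ α β σ : ℝ} (hθ1 : θ ≤ 1) (hβ0 : 0 ≤ β) (hσ : 0 ≤ σ)
    {F : Rd d → Rd d → ℝ≥0∞} (hF0 : ∀ x, F x x = 0) :
    ∫⁻ z in Ω, ENNReal.ofReal (distBd Ω z ^ (-(d + σ + α + β))) * localOsc Ω θ F z ≤
      ENNReal.ofReal (2 ^ β) * ∫⁻ x in Ω, ∫⁻ y in ball x (θ * distBd Ω x), F x y *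
        (ENNReal.ofReal (dist x y ^ (-(d + σ))) * ENNReal.ofReal (distBd Ω y ^ (-β)) *
          ENNReal.ofReal (distBd Ω x ^ (-α))) := by
  rw [← lintegral_const_mul' _ _ ENNReal.ofReal_ne_top]
  refine setLIntegral_mono' hΩ.measurableSet fun x hx => ?_
  have hδ := distBd_pos hΩ hfr hx
  rw [localOsc, ← lintegral_const_mul' _ _ ENNReal.ofReal_ne_top,
    ← lintegral_const_mul' _ _ ENNReal.ofReal_ne_top]
  refine setLIntegral_mono' measurableSet_ball fun y hy => ?_
  rcases eq_or_ne x y with rfl | hxy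
  · simp [hF0]
  have hdist : 0 < dist x y := dist_pos.2 hxy
  have hlt : dist x y < distBd Ω x := by
    rw [mem_ball'] at hy
    nlinarith
  have hδy := distBd_pos hΩ hfr (ball_distBd_subset hΩ hx (mem_ball'.2 hlt))
  have hδy2 : distBd Ω y ≤ 2 * distBd Ω x := by
    have := distBd_le_add Ω y x
    rw [dist_comm] at this
    linarith
  have hreal : distBd Ω x ^ (-(d + σ + α + β)) ≤ 2 ^ β * (dist x y ^ (-(d + σ)) *
      distBd Ω y ^ (-β) * distBd Ω x ^ (-α)) := by
    have h1 : distBd Ω x ^ (-(d + σ)) ≤ dist x y ^ (-(d + σ)) :=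
      Real.rpow_le_rpow_of_nonpos hdist hlt.le (by linarith [d.cast_nonneg (α := ℝ)])
    have h2 : distBd Ω x ^ (-β) ≤ 2 ^ β * distBd Ω y ^ (-β) := by
      have := Real.rpow_le_rpow_of_nonpos hδy hδy2 (neg_nonpos.2 hβ0)
      rw [Real.mul_rpow (by norm_num) hδ.le, Real.rpow_neg (by norm_num), ← div_eq_inv_mul,
        div_le_iff₀ (by positivity)] at this
      linarith
    have e : distBd Ω x ^ (-(d + σ + α + β)) =
        distBd Ω x ^ (-(d + σ)) * distBd Ω x ^ (-β) * distBd Ω x ^ (-α) := by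
      rw [← Real.rpow_add hδ, ← Real.rpow_add hδ]
      ring_nf
    rw [e]
    calc _ ≤ dist x y ^ (-(d + σ)) * (2 ^ β * distBd Ω y ^ (-β)) * distBd Ω x ^ (-α) := by gcongr
      _ = _ := by ring
  calc _ ≤ ENNReal.ofReal (2 ^ β * (dist x y ^ (-(d + σ)) *
        distBd Ω y ^ (-β) * distBd Ω x ^ (-α))) * F x y := by gcongr
    _ = _ := by
      rw [ENNReal.ofReal_mul (by positivity), ENNReal.ofReal_mul (by positivity),
        ENNReal.ofReal_mul (by positivity)]
      ring

theorem ofReal_gagliardo_integrand {d : ℕ} (Ω : Set (Rd d)) (σ p α β : ℝ) (f : Rd d → ℝ)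
    (x y : Rd d) :
    ENNReal.ofReal (|f x - f y| ^ p / dist x y ^ ((d : ℝ) + σ) * distBd Ω y ^ (-β) *
      distBd Ω x ^ (-α)) = oscPow p f x y * (ENNReal.ofReal (dist x y ^ (-(d + σ))) *
        ENNReal.ofReal (distBd Ω y ^ (-β)) * ENNReal.ofReal (distBd Ω x ^ (-α))) := by
  have hx := distBd_nonneg Ω x
  have hy := distBd_nonneg Ω y
  rw [oscPow, ← ENNReal.ofReal_mul (by positivity), ← ENNReal.ofReal_mul (by positivity),
    ← ENNReal.ofReal_mul (by positivity), Real.rpow_neg dist_nonneg]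
  ring_nf

/-- A double integral whose integrand is dominated away from the sets `S x` is bounded by the
dominating double integrals and the integral over the sets `S x`. -/
theorem lintegral_lintegral_le_of_far_le {X : Type*} [MeasurableSpace X] {μ : Measure X} [SFinite μ]
    {Ω : Set X} (hΩ : MeasurableSet Ω) {S : X → Set X} (hS : ∀ x, MeasurableSet (S x))
    {E N₁ N₂ : X → X → ℝ≥0∞} (hN₁ : Measurable (Function.uncurry N₁))
    (hN₂ : Measurable (Function.uncurry N₂)) {M : ℝ≥0∞} (hM : M ≠ ⊤)
    (h : ∀ x ∈ Ω, ∀ y ∈ Ω, y ∉ S x → E x y ≤ M * (N₁ x y + N₂ y x)) :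
    ∫⁻ x in Ω, ∫⁻ y in Ω, E x y ∂μ ∂μ ≤
      M * ((∫⁻ x in Ω, ∫⁻ y in Ω, N₁ x y ∂μ ∂μ) + ∫⁻ x in Ω, ∫⁻ y in Ω, N₂ x y ∂μ ∂μ) +
        ∫⁻ x in Ω, ∫⁻ y in S x, E x y ∂μ ∂μ := by
  have hsplit : ∀ x ∈ Ω, ∫⁻ y in Ω, E x y ∂μ ≤
      M * ((∫⁻ y in Ω, N₁ x y ∂μ) + ∫⁻ y in Ω, N₂ y x ∂μ) + ∫⁻ y in S x, E x y ∂μ := by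
    intro x hx
    rw [← lintegral_inter_add_sdiff _ Ω (hS x), add_comm]
    refine add_le_add ?_ (lintegral_mono_set inter_subset_right)
    rw [← lintegral_add_left (f := N₁ x) (hN₁.comp measurable_prodMk_left), ← lintegral_const_mul' _ _ hM]
    exact (setLIntegral_mono' (hΩ.diff (hS x)) fun y hy => h x hx y hy.1 hy.2).trans
      (lintegral_mono_set sdiff_subset)
  have hm₁ : Measurable fun x => ∫⁻ y in Ω, N₁ x y ∂μ := hN₁.lintegral_prod_right'
  have hm₂ : Measurable fun x => ∫⁻ y in Ω, N₂ y x ∂μ := hN₂.lintegral_prod_left'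
  refine (setLIntegral_mono' hΩ hsplit).trans (le_of_eq ?_)
  rw [lintegral_add_left (by fun_prop), lintegral_const_mul' _ _ hM,
    lintegral_add_left hm₁, lintegral_lintegral_swap (f := N₂) hN₂.aemeasurable]

theorem mul_le_chainKernel_add {d : ℕ} {Ω : Set (Rd d)} {α β σ ε B θ : ℝ} (hθ0 : 0 < θ)
    (hθ1 : θ ≤ 1) {O : Rd d → ℝ≥0∞} {M F : ℝ≥0∞} {x y : Rd d} (hxy : θ * distBd Ω x ≤ dist x y)
    (h : θ / 2 * distBd Ω x ≤ dist x y → θ / 2 * distBd Ω y ≤ dist x y →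
      F ≤ M * (chainBound Ω ε B O x (dist x y) + chainBound Ω ε B O y (dist x y))) :
    F * (ENNReal.ofReal (dist x y ^ (-(d + σ))) * ENNReal.ofReal (distBd Ω y ^ (-β)) *
        ENNReal.ofReal (distBd Ω x ^ (-α))) ≤
      M * (chainKernel Ω α β σ ε B (θ / 2) O x y + chainKernel Ω β α σ ε B (θ / 2) O y x) := by
  have hx2 : θ / 2 * distBd Ω x ≤ dist x y := by nlinarith [distBd_nonneg Ω x]
  have hy2 : θ / 2 * distBd Ω y ≤ dist x y := by
    have h1 := distBd_le_add Ω y x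
    rw [dist_comm] at h1
    have h2 : θ * dist x y ≤ dist x y := mul_le_of_le_one_left dist_nonneg hθ1
    nlinarith
  have hmem₁ : (x, y) ∈ {q : Rd d × Rd d | θ / 2 * distBd Ω q.1 ≤ dist q.1 q.2} := hx2
  have hmem₂ : (y, x) ∈ {q : Rd d × Rd d | θ / 2 * distBd Ω q.1 ≤ dist q.1 q.2} := by
    rw [dist_comm] at hy2
    exact hy2
  rw [chainKernel, chainKernel, indicator_of_mem hmem₁, indicator_of_mem hmem₂]
  simp only [dist_comm y x]
  grw [h hx2 hy2]
  apply le_of_eq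
  ring

theorem exists_gagP_le_of_measurable {d : ℕ} {Ω : Set (Rd d)} (hΩ : IsOpen Ω)
    (hbdd : Bornology.IsBounded Ω) (hunif : IsUniformDomain Ω) (hfr : (frontier Ω).Nonempty)
    (hdiam : 0 < Metric.ediam (frontier Ω)) {q s p θ α β : ℝ}
    (hq : q ∈ lowerCodimSet (frontier Ω)) (hα : α < q) (hα0 : 0 ≤ α) (hβ : β < q) (hβ0 : 0 ≤ β)
    (hs : 0 < s) (hp : 1 ≤ p) (hθ0 : 0 < θ) (hθ1 : θ ≤ 1) :
    ∃ A : ℝ≥0∞, A ≠ ⊤ ∧ ∀ f : Rd d → ℝ, Measurable f →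
      gagP Ω s p α β f ≤ A * ∫⁻ x in Ω, ∫⁻ y in ball x (θ * distBd Ω x), ENNReal.ofReal
          (|f x - f y| ^ p / dist x y ^ ((d : ℝ) + s * p)
            * distBd Ω y ^ (-β) * distBd Ω x ^ (-α)) := by
  have hp0 : 0 < p := by linarith
  have hσ : 0 < s * p := by positivity
  obtain ⟨C, hC, hU⟩ := hunif
  have hε : 0 < s * p / 2 := by positivity
  obtain ⟨b₁, hb₁, htri₁⟩ := exists_oscPow_triangle hp0 (one_lt_two (α := ℝ))
  obtain ⟨b₂, hb₂, htri₂⟩ := exists_oscPow_triangle hp0 (Real.one_lt_rpow one_lt_two hε)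
  obtain ⟨M, B, hM, hB, hchain⟩ := exists_le_chainBound_add hΩ hfr hC hU hθ0 hθ1 hε
    (L := max (ENNReal.ofReal 2) b₁) (le_max_of_le_left (by simp)) (by simp [hb₁]) hb₂
  obtain ⟨A₁, hA₁, h₁⟩ := exists_lintegral_chainKernel_le hΩ hbdd hfr hdiam hq hα hα0 hβ hβ0 hB
    (σ := s * p) (ε := s * p / 2) (τ := θ / 2) (by linarith) (by positivity)
  obtain ⟨A₂, hA₂, h₂⟩ := exists_lintegral_chainKernel_le hΩ hbdd hfr hdiam hq hβ hβ0 hα hα0 hB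
    (σ := s * p) (ε := s * p / 2) (τ := θ / 2) (by linarith) (by positivity)
  refine ⟨1 + M * (A₁ + A₂) * ENNReal.ofReal (2 ^ β), by finiteness, fun f hf => ?_⟩
  have hF := measurable_oscPow p hf
  set O := localOsc Ω θ (oscPow p f) with hO
  have hOm : Measurable O := measurable_localOsc Ω θ hF
  simp only [gagP, ofReal_gagliardo_integrand]
  have hnear := lintegral_localOsc_le hΩ hfr (α := α) hθ1 hβ0 hσ.le (oscPow_self hp0 f)
  have hfar := lintegral_lintegral_le_of_far_le (μ := volume) hΩ.measurableSet
    (S := fun x => ball x (θ * distBd Ω x)) (fun x => measurableSet_ball)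
    (measurable_chainKernel hΩ α β (s * p) (s * p / 2) B (θ / 2) hOm)
    (measurable_chainKernel hΩ β α (s * p) (s * p / 2) B (θ / 2) hOm) hM
    fun x hx y hy hxy => mul_le_chainKernel_add (F := oscPow p f x y) (σ := s * p) (α := α) (β := β)
      hθ0 hθ1 (not_lt.1 fun h => hxy (mem_ball'.2 h)) (hchain (oscPow p f) hF (oscPow_comm p f)
      (fun x y z => (htri₁ f x y z).trans (by gcongr; exacts [le_max_left _ _, le_max_right _ _]))
      (fun x y z => htri₂ f x y z) x hx y hy)
  have h₂' := h₂ O hOm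
  rw [show (d : ℝ) + s * p + β + α = d + s * p + α + β by ring] at h₂'
  refine hfar.trans ?_
  grw [h₁ O hOm, h₂', hnear]
  apply le_of_eq
  ring

/-- comparability between the full weighted Gagliardo seminorm and the
truncated one, for a nonempty bounded uniform domain and distance weights with exponents
`0 ≤ α, β < codim_A(∂Ω)`. -/
theorem stmt0 {d : ℕ} (Ω : Set (Rd d)) (hne : Ω.Nonempty)
    (hopen : IsOpen Ω) (hconn : IsConnected Ω) (hbdd : Bornology.IsBounded Ω)
    (hunif : IsUniformDomain Ω) (s p θ α β : ℝ)
    (hs0 : 0 < s) (hs1 : s < 1) (hp : 1 ≤ p) (hθ0 : 0 < θ) (hθ1 : θ ≤ 1)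
    (hα0 : 0 ≤ α) (hα : α < lowerCodimA (frontier Ω))
    (hβ0 : 0 ≤ β) (hβ : β < lowerCodimA (frontier Ω)) :
    ∃ C : ℝ, 0 < C ∧ ∀ f : Rd d → ℝ, LocallyIntegrableOn f Ω volume →
      gagP Ω s p α β f ≤ ENNReal.ofReal C *
        ∫⁻ x in Ω, ∫⁻ y in Metric.ball x (θ * distBd Ω x), ENNReal.ofReal
          (|f x - f y| ^ p / dist x y ^ ((d : ℝ) + s * p)
            * distBd Ω y ^ (-β) * distBd Ω x ^ (-α)) := by
  have : NeZero d := ⟨dim_ne_zero_of_lowerCodimA_pos (hα0.trans_lt hα)⟩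
  have hdiam : 0 < Metric.ediam (frontier Ω) := ediam_frontier_pos hopen hbdd hne
  have hfr : (frontier Ω).Nonempty := (Metric.ediam_pos_iff.1 hdiam).nonempty
  obtain ⟨q, hq, hq'⟩ := exists_mem_lowerCodimSet_gt (hα0.trans (le_max_left α β)) (max_lt hα hβ)
  obtain ⟨hαq, hβq⟩ := max_lt_iff.1 hq'
  obtain ⟨A, hA, hmain⟩ := exists_gagP_le_of_measurable hopen hbdd hunif hfr hdiam hq hαq hα0 hβq
    hβ0 hs0 hp hθ0 hθ1
  refine ⟨A.toReal + 1, by positivity, fun f hf => ?_⟩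
  have hfm := hf.aestronglyMeasurable.aemeasurable
  have hfg := hfm.ae_eq_mk
  have hmeas := hfm.measurable_mk
  set g := hfm.mk f
  have hlhs : gagP Ω s p α β f = gagP Ω s p α β g := by
    refine lintegral_congr_ae ?_
    filter_upwards [hfg] with x hx
    refine lintegral_congr_ae ?_
    filter_upwards [hfg] with y hy
    rw [hx, hy]
  have hrhs : (∫⁻ x in Ω, ∫⁻ y in ball x (θ * distBd Ω x), ENNReal.ofReal
        (|g x - g y| ^ p / dist x y ^ ((d : ℝ) + s * p)
          * distBd Ω y ^ (-β) * distBd Ω x ^ (-α))) =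
      ∫⁻ x in Ω, ∫⁻ y in ball x (θ * distBd Ω x), ENNReal.ofReal
        (|f x - f y| ^ p / dist x y ^ ((d : ℝ) + s * p)
          * distBd Ω y ^ (-β) * distBd Ω x ^ (-α)) := by
    refine lintegral_congr_ae ?_
    filter_upwards [hfg, ae_restrict_mem hopen.measurableSet] with x hx hxΩ
    have hsub : ball x (θ * distBd Ω x) ⊆ Ω :=
      (ball_subset_ball (mul_le_of_le_one_left (distBd_nonneg Ω x) hθ1)).trans
        (ball_distBd_subset hopen hxΩ)
    refine lintegral_congr_ae ?_
    filter_upwards [ae_restrict_of_ae_restrict_of_subset hsub hfg] with y hy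
    rw [hx, hy]
  rw [hlhs]
  refine (hmain g hmeas).trans ?_
  rw [hrhs]
  gcongr
  exact ENNReal.le_ofReal_iff_toReal_le hA (by positivity) |>.2 (by linarith)
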